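/- arXiv:math/0205183 — 4 statements merged into one kernel-verified Lean document; each statement's English description precedes it below -/
import Mathlib

section
/- There exists a threshold M such that for every integer m > M the Bernoulli polynomial B_m has a real root, and its largest real root 𝐀(m) satisfies m/(2πe) − (1/(πe) + 1/2) < 𝐀(m) < m/(2πe) + (log m)/(4πe) + (1 − 1/(2πe)). -/
open Real

/-- The `m`-th Bernoulli polynomial with real coefficients. -/
noncomputable def B (m : ℕ) : Polynomial ℝ :=
  (Polynomial.bernoulli m).map (algebraMap ℚ ℝ)

open Filter Topology

lemma four_approx : ∃ C : ℝ, 0 ≤ C ∧ ∀ m : ℕ, 2 ≤ m → ∀ x : ℝ, x ∈ Set.Icc (0:ℝ) 1 →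
    ‖(-(2 * (π:ℂ) * Complex.I) ^ m / (m.factorial : ℂ) * ((B m).eval x : ℝ)) -
      (Complex.exp (2 * π * Complex.I * x) + (-1) ^ m * Complex.exp (-(2 * π * Complex.I * x)))‖
      ≤ C * (1 / 2) ^ m := by
  have hs : Summable (fun n : ℕ => 1 / ((n:ℝ) + 2) ^ 2) := by
    have := (summable_nat_add_iff 2).mpr (Real.summable_one_div_nat_pow.mpr (by norm_num : 1 < 2))
    simpa using this
  refine ⟨8 * ∑' n : ℕ, 1 / ((n:ℝ) + 2) ^ 2, by positivity, ?_⟩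
  intro m hm x hx
  have h := (hasSum_nat_add_iff' 2).mpr (hasSum_one_div_nat_pow_mul_fourier hm hx)
  have hb : HasSum (fun n : ℕ => 8 * (1 / 2 : ℝ) ^ m * (1 / ((n:ℝ) + 2) ^ 2))
      (8 * (1 / 2 : ℝ) ^ m * ∑' n : ℕ, 1 / ((n:ℝ) + 2) ^ 2) := hs.hasSum.mul_left _
  have key := tsum_of_norm_bounded hb (f := fun n : ℕ =>
        (1 : ℂ) / ((n + 2 : ℕ) : ℂ) ^ m * (fourier ((n + 2 : ℕ) : ℤ) (x : UnitAddCircle)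
          + (-1 : ℂ) ^ m * fourier (-((n + 2 : ℕ) : ℤ)) (x : UnitAddCircle))) (by
    intro n
    obtain ⟨k, rfl⟩ := Nat.exists_eq_add_of_le hm
    have h1 : ∀ j : ℤ, ‖fourier j (x : UnitAddCircle)‖ = 1 := fun j => Circle.norm_coe _
    have h2 : ‖fourier ((n + 2 : ℕ) : ℤ) (x : UnitAddCircle)
          + (-1 : ℂ) ^ (2 + k) * fourier (-((n + 2 : ℕ) : ℤ)) (x : UnitAddCircle)‖ ≤ 2 := by
      refine (norm_add_le _ _).trans ?_
      rw [norm_mul, h1, h1]; norm_num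
    have h3 : ‖(1 : ℂ) / ((n + 2 : ℕ) : ℂ) ^ (2 + k)‖ = 1 / ((n:ℝ) + 2) ^ 2 * (1 / ((n:ℝ) + 2)) ^ k := by
      rw [norm_div, norm_pow, Complex.norm_natCast, norm_one, pow_add]
      push_cast
      rw [one_div_pow]
      field_simp
    rw [norm_mul, h3]
    have h4 : (1 / ((n:ℝ) + 2)) ^ k ≤ (1 / 2) ^ k := by
      gcongr
      linarith [(Nat.cast_nonneg n : (0:ℝ) ≤ n)]
    calc _ ≤ 1 / ((n:ℝ) + 2) ^ 2 * (1 / 2) ^ k * 2 := by gcongr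
      _ = _ := by rw [pow_add]; ring)
  rw [h.tsum_eq] at key
  have e0 : (0:ℂ) ^ m = 0 := zero_pow (by omega)
  rw [Finset.sum_range_succ, Finset.sum_range_one] at key
  simp only [Nat.cast_zero, e0, Nat.cast_one, one_pow, div_zero, zero_mul, zero_add, div_one,
    one_mul, fourier_coe_apply] at key
  have e1 : bernoulliFun m x = (B m).eval x := rfl
  rw [e1] at key
  convert key using 1
  · push_cast
    congr 4
    · ring_nf
    · ring_nf
  · ring

lemma B_add_one (m : ℕ) (x : ℝ) : (B m).eval (x + 1) = (B m).eval x + m * x ^ (m - 1) := by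
  have h := Polynomial.bernoulli_comp_one_add_X m
  have := congrArg (fun p => (Polynomial.map (algebraMap ℚ ℝ) p).eval x) h
  simp [Polynomial.map_comp] at this
  rw [add_comm x 1]
  simpa [B, Polynomial.eval_map_algebraMap] using this

lemma B_add_nat (m : ℕ) (x : ℝ) (n : ℕ) :
    (B m).eval (x + n) = (B m).eval x + m * ∑ k ∈ Finset.range n, (x + k) ^ (m - 1) := by
  induction n with
  | zero => simp
  | succ n ih =>
    rw [Finset.sum_range_succ, Nat.cast_succ, ← add_assoc, B_add_one, ih]; ring

lemma sum_upper (m : ℕ) (hm : 1 ≤ m) (x : ℝ) (hx : 0 ≤ x) (n : ℕ) :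
    m * ∑ k ∈ Finset.range n, (x + k) ^ (m - 1) ≤ (x + n) ^ m := by
  induction n with
  | zero => simp; positivity
  | succ n ih =>
    rw [Finset.sum_range_succ, mul_add]
    have hy : 0 ≤ x + n := by positivity
    have : (x + n) ^ m + m * (x + n) ^ (m - 1) ≤ (x + n + 1) ^ m := by
      generalize x + n = y at hy
      obtain ⟨k, rfl⟩ := Nat.exists_eq_add_of_le' hm
      clear ih hm
      simp only [Nat.add_sub_cancel]
      induction k with
      | zero => simp
      | succ k ih =>
        rw [pow_succ (y + 1)]
        have := mul_le_mul_of_nonneg_right ih (by linarith : 0 ≤ y + 1)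
        refine le_trans ?_ this
        push_cast
        have h0 : 0 ≤ y ^ k := by positivity
        have : (y ^ (k + 1) + (k + 1) * y ^ k) * (y + 1) =
          y ^ (k + 1 + 1) + (k + 1 + 1) * y ^ (k + 1) + (k + 1) * y ^ k := by ring
        rw [this]
        have : 0 ≤ ((k:ℝ) + 1) * y ^ k := by positivity
        linarith
    push_cast
    rw [← add_assoc]
    linarith

/-- uniform bound on the unit interval -/
lemma B_bound {C : ℝ} {m : ℕ} {x : ℝ}
    (h : ‖(-(2 * (π:ℂ) * Complex.I) ^ m / (m.factorial : ℂ) * ((B m).eval x : ℝ)) -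
      (Complex.exp (2 * π * Complex.I * x) + (-1) ^ m * Complex.exp (-(2 * π * Complex.I * x)))‖
      ≤ C) : |(B m).eval x| ≤ m.factorial / (2 * π) ^ m * (2 + C) := by
  have h1 : ‖Complex.exp (2 * π * Complex.I * x) +
      (-1) ^ m * Complex.exp (-(2 * π * Complex.I * x))‖ ≤ 2 := by
    refine (norm_add_le _ _).trans ?_
    rw [norm_mul, Complex.norm_exp, Complex.norm_exp]
    norm_num
  have h2 := (norm_sub_norm_le _ _).trans h
  have h3 : ‖(-(2 * (π:ℂ) * Complex.I) ^ m / (m.factorial : ℂ) * ((B m).eval x : ℝ))‖ =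
      (2 * π) ^ m / m.factorial * |(B m).eval x| := by
    rw [norm_mul, norm_div, norm_neg, norm_pow]
    simp [abs_of_pos Real.pi_pos]
  rw [h3] at h2
  have h4 : (2 * π) ^ m / m.factorial * |(B m).eval x| ≤ 2 + C := by linarith
  have hp : 0 < (2 * π) ^ m := by positivity
  have hf : (0:ℝ) < m.factorial := by positivity
  calc |(B m).eval x| = m.factorial / (2 * π) ^ m * ((2 * π) ^ m / m.factorial * |(B m).eval x|) := by
        field_simp
    _ ≤ _ := by gcongr

lemma B_neg {C : ℝ} {m : ℕ} {x : ℝ} {j : ℤ} (hx : x = m / 4 + j)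
    (h : ‖(-(2 * (π:ℂ) * Complex.I) ^ m / (m.factorial : ℂ) * ((B m).eval x : ℝ)) -
      (Complex.exp (2 * π * Complex.I * x) + (-1) ^ m * Complex.exp (-(2 * π * Complex.I * x)))‖
      ≤ C) : (B m).eval x ≤ - (m.factorial / (2 * π) ^ m * (2 - C)) := by
  have hI : Complex.exp (π / 2 * Complex.I) = Complex.I := Complex.exp_pi_div_two_mul_I
  have e1 : Complex.exp (2 * π * Complex.I * x) = Complex.I ^ m := by
    rw [hx]
    have : (2 * π * Complex.I * ((m / 4 + j : ℝ) : ℂ)) =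
      m * (π / 2 * Complex.I) + j * (2 * π * Complex.I) := by push_cast; ring
    rw [this, Complex.exp_add, Complex.exp_nat_mul, hI, Complex.exp_int_mul_two_pi_mul_I, mul_one]
  have e2 : (-1) ^ m * Complex.exp (-(2 * π * Complex.I * x)) = Complex.I ^ m := by
    rw [Complex.exp_neg, e1, ← inv_pow, Complex.inv_I, ← mul_pow]
    simp
  rw [e1, e2] at h
  have e3 : (-(2 * (π:ℂ) * Complex.I) ^ m / (m.factorial : ℂ) * ((B m).eval x : ℝ)) -
      (Complex.I ^ m + Complex.I ^ m) =
      Complex.I ^ m * ((-((2 * π) ^ m / m.factorial * (B m).eval x) - 2 : ℝ) : ℂ) := by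
    rw [mul_pow (2 * (π:ℂ)) Complex.I]
    push_cast
    ring
  rw [e3, norm_mul, norm_pow, Complex.norm_I, one_pow, one_mul, Complex.norm_real,
    Real.norm_eq_abs] at h
  have h5 := (abs_le.mp h).1
  have h4 : (2 * π) ^ m / m.factorial * (B m).eval x ≤ -(2 - C) := by linarith
  have hp : 0 < (2 * π) ^ m := by positivity
  have hf : (0:ℝ) < m.factorial := by positivity
  calc (B m).eval x = m.factorial / (2 * π) ^ m * ((2 * π) ^ m / m.factorial * (B m).eval x) := by
        field_simp
    _ ≤ m.factorial / (2 * π) ^ m * (-(2 - C)) := by gcongr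
    _ = _ := by ring

lemma key_upper (C : ℝ) : ∀ᶠ N : ℕ in atTop,
    N.factorial / (2 * π) * (2 + C * (1 / 2) ^ (N + 1)) <
      (((N:ℝ) + Real.log (N + 1) / 2) / Real.exp 1) ^ N := by
  have hgeo : Tendsto (fun N : ℕ => 2 + C * (1 / 2 : ℝ) ^ (N + 1)) atTop (𝓝 2) := by
    have h := (tendsto_pow_atTop_nhds_zero_of_lt_one (by norm_num : (0:ℝ) ≤ 1 / 2)
      (by norm_num)).comp (tendsto_add_atTop_nat 1)
    simpa using (h.const_mul C).const_add 2
  have hdel : Tendsto (fun N : ℕ => Real.log (N + 1) ^ 2 / (8 * N)) atTop (𝓝 0) := by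
    have h := (Real.tendsto_pow_log_div_mul_add_atTop 8 (-8) 2 (by norm_num)).comp
      (tendsto_natCast_atTop_atTop.comp (tendsto_add_atTop_nat 1))
    refine h.congr fun N => ?_
    simp only [Function.comp_apply]
    push_cast
    congr 1
    ring
  have hexp : Tendsto (fun N : ℕ => Real.exp (-(Real.log (N + 1) ^ 2 / (8 * N)))) atTop (𝓝 1) := by
    have h := (Real.continuous_exp.tendsto _).comp hdel.neg
    rw [neg_zero, Real.exp_zero] at h
    exact h
  have hl : Tendsto (fun N : ℕ => Stirling.stirlingSeq N * √2 / (2 * π) *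
      (2 + C * (1 / 2 : ℝ) ^ (N + 1))) atTop (𝓝 (√π * √2 / (2 * π) * 2)) :=
    ((Stirling.tendsto_stirlingSeq_sqrt_pi.mul_const _).div_const _).mul hgeo
  have hlt : √π * √2 / (2 * π) * 2 < 1 := by
    have h1 : √π * √2 < π := by
      rw [← Real.sqrt_mul Real.pi_pos.le, Real.sqrt_lt' Real.pi_pos]
      nlinarith [Real.pi_gt_three]
    have : √π * √2 / (2 * π) * 2 = √π * √2 / π := by field_simp
    rw [this, div_lt_one Real.pi_pos]
    exact h1
  filter_upwards [hl.eventually_lt hexp hlt, eventually_ge_atTop 1] with N hN hN1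
  have hNp : (0:ℝ) < N := by exact_mod_cast hN1
  have hLp : 0 ≤ Real.log ((N:ℝ) + 1) := Real.log_nonneg (by linarith)
  set L := Real.log ((N:ℝ) + 1) with hL
  set t := L / (2 * N) with ht
  have ht0 : 0 ≤ t := by positivity
  have hw : (((N:ℝ) + L / 2) / Real.exp 1) ^ N = (N / Real.exp 1) ^ N * (1 + t) ^ N := by
    rw [← mul_pow]; congr 1; rw [ht]; field_simp
  have h1 : t - t ^ 2 / 2 ≤ Real.log (1 + t) := by
    refine le_trans ?_ (Real.le_log_one_add_of_nonneg ht0)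
    rw [le_div_iff₀ (by linarith)]
    nlinarith [pow_nonneg ht0 3]
  have h2 : √(N:ℝ) * Real.exp (-(L ^ 2 / (8 * N))) ≤ (1 + t) ^ N := by
    have e1 : (1 + t) ^ N = Real.exp (N * Real.log (1 + t)) := by
      rw [Real.exp_nat_mul, Real.exp_log (by linarith)]
    have e2 : √(N:ℝ) ≤ Real.exp (L / 2) := by
      rw [Real.exp_half, hL, Real.exp_log (by linarith)]
      exact Real.sqrt_le_sqrt (by linarith)
    have e3 : L / 2 + -(L ^ 2 / (8 * N)) ≤ N * Real.log (1 + t) := by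
      refine le_trans (le_of_eq ?_) (mul_le_mul_of_nonneg_left h1 hNp.le)
      rw [ht]; field_simp; ring
    rw [e1]
    refine le_trans ?_ (Real.exp_le_exp.mpr e3)
    rw [Real.exp_add]
    gcongr
  have hp : 0 < √(N:ℝ) * ((N:ℝ) / Real.exp 1) ^ N := by positivity
  have hfac : (N.factorial : ℝ) = Stirling.stirlingSeq N * √2 * (√(N:ℝ) * ((N:ℝ) / Real.exp 1) ^ N) := by
    have : √(2 * (N:ℝ)) = √2 * √(N:ℝ) := Real.sqrt_mul (by norm_num) _
    rw [Stirling.stirlingSeq, this]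
    field_simp
  rw [hw]
  calc _ = (√(N:ℝ) * ((N:ℝ) / Real.exp 1) ^ N) * (Stirling.stirlingSeq N * √2 / (2 * π) *
      (2 + C * (1 / 2 : ℝ) ^ (N + 1))) := by rw [hfac]; ring
    _ < (√(N:ℝ) * ((N:ℝ) / Real.exp 1) ^ N) * Real.exp (-(L ^ 2 / (8 * N))) :=
        mul_lt_mul_of_pos_left hN hp
    _ = (N / Real.exp 1) ^ N * (√(N:ℝ) * Real.exp (-(L ^ 2 / (8 * N)))) := by ring
    _ ≤ _ := by gcongr

lemma key_lower (C : ℝ) : ∀ᶠ m : ℕ in atTop, ∀ b : ℝ, 0 ≤ b →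
    b ≤ m / (2 * π * Real.exp 1) + 1 / 2 →
    b ^ m < m.factorial / (2 * π) ^ m * (2 - C * (1 / 2) ^ m) := by
  have hgeo : Tendsto (fun N : ℕ => 2 - C * (1 / 2 : ℝ) ^ N) atTop (𝓝 2) := by
    have h := (tendsto_pow_atTop_nhds_zero_of_lt_one (by norm_num : (0:ℝ) ≤ 1 / 2)
      (by norm_num))
    simpa using (h.const_mul C).const_sub 2
  have hs : Tendsto (fun m : ℕ => √(2 * π * (m:ℝ))) atTop atTop :=
    Real.tendsto_sqrt_atTop.comp
      (tendsto_natCast_atTop_atTop.const_mul_atTop (by positivity))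
  filter_upwards [hgeo.eventually (lt_mem_nhds (by norm_num : (1:ℝ) < 2)),
    hs.eventually_gt_atTop (Real.exp (π * Real.exp 1)), eventually_ge_atTop 1] with m h1 h2 h3 b hb0 hb
  have hmp : (0:ℝ) < m := by exact_mod_cast h3
  have hpp := Real.pi_pos
  have hE := Real.exp_pos 1
  have a1 : 2 * π * b ≤ m / Real.exp 1 * Real.exp (π * Real.exp 1 / m) := by
    have : 2 * π * b ≤ m / Real.exp 1 * (π * Real.exp 1 / m + 1) := by
      calc 2 * π * b ≤ 2 * π * (m / (2 * π * Real.exp 1) + 1 / 2) := by gcongr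
        _ = _ := by field_simp; ring
    refine this.trans ?_
    gcongr
    exact Real.add_one_le_exp _
  have a2 : (2 * π * b) ^ m ≤ (m / Real.exp 1) ^ m * Real.exp (π * Real.exp 1) := by
    calc (2 * π * b) ^ m ≤ (m / Real.exp 1 * Real.exp (π * Real.exp 1 / m)) ^ m := by gcongr
      _ = _ := by
        rw [mul_pow, ← Real.exp_nat_mul]
        congr 2
        exact mul_div_cancel₀ _ hmp.ne'
  have a3 : (2 * π * b) ^ m < m.factorial := by
    refine lt_of_le_of_lt a2 (lt_of_lt_of_le ?_ (Stirling.le_factorial_stirling m))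
    rw [mul_comm]
    gcongr
  have a4 : b ^ m < m.factorial / (2 * π) ^ m := by
    rw [lt_div_iff₀ (by positivity), ← mul_pow, mul_comm b]
    exact a3
  have : (0:ℝ) < m.factorial / (2 * π) ^ m := by positivity
  nlinarith

lemma pos_upper : ∀ᶠ m : ℕ in atTop, ∀ a : ℝ,
    (m : ℝ) / (2 * π * Real.exp 1) + Real.log m / (4 * π * Real.exp 1) +
          (1 - 1 / (2 * π * Real.exp 1)) ≤ a → 0 < (B m).eval a := by
  obtain ⟨C, hC, hF⟩ := four_approx
  have hk := (key_upper C)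
  rw [eventually_atTop] at hk ⊢
  obtain ⟨N0, hN0⟩ := hk
  refine ⟨N0 + 2, fun m hm a ha => ?_⟩
  obtain ⟨N, rfl⟩ : ∃ N, m = N + 1 := ⟨m - 1, by omega⟩
  have hN := hN0 N (by omega)
  have hNp : (0:ℝ) < N := by exact_mod_cast (by omega : 0 < N)
  have hpp := Real.pi_pos
  have hE := Real.exp_pos 1
  push_cast at ha
  have hLp : 0 ≤ Real.log ((N:ℝ) + 1) := Real.log_nonneg (by linarith)
  have hw : ((N:ℝ) + Real.log (N + 1) / 2) / Real.exp 1 ≤ 2 * π * (a - 1) := by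
    calc _ = 2 * π * (((N:ℝ) + 1) / (2 * π * Real.exp 1) + Real.log (N + 1) / (4 * π * Real.exp 1) +
          (1 - 1 / (2 * π * Real.exp 1)) - 1) := by field_simp; ring
      _ ≤ _ := by gcongr
  have hw0 : 0 < ((N:ℝ) + Real.log (N + 1) / 2) / Real.exp 1 := by positivity
  have ha1 : 0 < a - 1 := by
    by_contra h
    push Not at h
    nlinarith
  have hn1 : 1 ≤ ⌊a⌋₊ := Nat.le_floor (by push_cast; linarith)
  obtain ⟨n, hn⟩ : ∃ n, ⌊a⌋₊ = n + 1 := ⟨⌊a⌋₊ - 1, by omega⟩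
  have hf1 := Nat.floor_le (by linarith : 0 ≤ a)
  have hf2 := Nat.lt_floor_add_one a
  rw [hn] at hf1 hf2
  set x := a - ((n + 1 : ℕ) : ℝ) with hx
  have hx0 : 0 ≤ x := by linarith
  have hax : a = x + ((n + 1 : ℕ) : ℝ) := by rw [hx]; ring
  have hb := B_bound (hF (N + 1) (by omega) x ⟨hx0, by linarith⟩)
  have hb1 := (abs_le.mp hb).1
  rw [hax, B_add_nat, Finset.sum_range_succ]
  have hxn : x + (n:ℝ) = a - 1 := by rw [hx]; push_cast; ring
  have hs : 0 ≤ ∑ k ∈ Finset.range n, (x + (k:ℝ)) ^ (N + 1 - 1) :=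
    Finset.sum_nonneg fun k _ => by positivity
  rw [hxn, Nat.add_sub_cancel] at *
  have hpow : (((N:ℝ) + Real.log (N + 1) / 2) / Real.exp 1) ^ N ≤ (2 * π) ^ N * (a - 1) ^ N := by
    rw [← mul_pow]; gcongr
  have hfin : ((N + 1).factorial : ℝ) / (2 * π) ^ (N + 1) * (2 + C * (1 / 2) ^ (N + 1)) <
      ((N + 1 : ℕ) : ℝ) * (a - 1) ^ N := by
    have h1 := lt_of_lt_of_le hN hpow
    have hp : 0 < (2 * π) ^ N := by positivity
    calc _ = ((N + 1 : ℕ) : ℝ) / (2 * π) ^ N * (N.factorial / (2 * π) * (2 + C * (1 / 2) ^ (N + 1))) := by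
          rw [Nat.factorial_succ]; push_cast; field_simp; ring
      _ < ((N + 1 : ℕ) : ℝ) / (2 * π) ^ N * ((2 * π) ^ N * (a - 1) ^ N) := by
          apply mul_lt_mul_of_pos_left h1; positivity
      _ = _ := by field_simp
  have : 0 ≤ ((N + 1 : ℕ) : ℝ) * ∑ k ∈ Finset.range n, (x + (k:ℝ)) ^ N := by positivity
  rw [mul_add]
  linarith

lemma neg_lower : ∀ᶠ m : ℕ in atTop, ∃ b : ℝ,
    (m : ℝ) / (2 * π * Real.exp 1) - (1 / (π * Real.exp 1) + 1 / 2) < b ∧ (B m).eval b < 0 := by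
  obtain ⟨C, hC, hF⟩ := four_approx
  have hpp := Real.pi_pos
  have hE := Real.exp_pos 1
  have ht : Tendsto (fun m : ℕ => (m : ℝ) / (2 * π * Real.exp 1)) atTop atTop :=
    tendsto_natCast_atTop_atTop.atTop_div_const (by positivity)
  filter_upwards [key_lower C, ht.eventually_ge_atTop (1 / (π * Real.exp 1) + 1 / 2),
    eventually_ge_atTop 2] with m hm hL hm2
  set L := (m : ℝ) / (2 * π * Real.exp 1) - (1 / (π * Real.exp 1) + 1 / 2) with hLdef
  have hL0 : 0 ≤ L := by linarith
  set j := ⌊L - m / 4⌋ with hj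
  have j1 := Int.floor_le (L - m / 4)
  have j2 := Int.lt_floor_add_one (L - m / 4)
  rw [← hj] at j1 j2
  refine ⟨m / 4 + j + 1, by linarith, ?_⟩
  set b : ℝ := m / 4 + j + 1 with hb
  have hb0 : 0 ≤ b := by linarith
  have hbu : b ≤ m / (2 * π * Real.exp 1) + 1 / 2 := by
    have : 0 < 1 / (π * Real.exp 1) := by positivity
    linarith
  have hk := hm b hb0 hbu
  have hf1 := Nat.floor_le hb0
  have hf2 := Nat.lt_floor_add_one b
  set n := ⌊b⌋₊
  set x := b - (n : ℝ) with hx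
  have hbx : b = x + n := by rw [hx]; ring
  have hneg := B_neg (j := j + 1 - n) (x := x) (by rw [hx, hb]; push_cast; ring)
    (hF m hm2 x ⟨by linarith, by linarith⟩)
  have hs := sum_upper m (by omega) x (by linarith) n
  rw [← hbx] at hs
  rw [hbx, B_add_nat]
  linarith

theorem stmt_12 :
    ∃ M : ℕ, ∀ m : ℕ, M < m →
      ∃ A : ℝ, (B m).IsRoot A ∧ (∀ x : ℝ, (B m).IsRoot x → x ≤ A) ∧
        (m : ℝ) / (2 * π * Real.exp 1) - (1 / (π * Real.exp 1) + 1 / 2) < A ∧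
        A < (m : ℝ) / (2 * π * Real.exp 1) + Real.log m / (4 * π * Real.exp 1) +
          (1 - 1 / (2 * π * Real.exp 1)) := by
  obtain ⟨M, hM⟩ := eventually_atTop.mp (pos_upper.and neg_lower)
  refine ⟨M, fun m hm => ?_⟩
  obtain ⟨hpos, b, hb, hneg⟩ := hM m hm.le
  set U := (m : ℝ) / (2 * π * Real.exp 1) + Real.log m / (4 * π * Real.exp 1) +
          (1 - 1 / (2 * π * Real.exp 1)) with hU
  have hbU : b < U := by
    by_contra h
    exact absurd (hpos b (not_lt.mp h)) (not_lt.mpr hneg.le)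
  obtain ⟨r, hr, hr0⟩ := intermediate_value_Icc hbU.le (f := fun x => (B m).eval x)
    (Polynomial.continuous _).continuousOn ⟨hneg.le, (hpos U le_rfl).le⟩
  have hne : B m ≠ 0 := by
    intro h
    rw [h] at hneg
    simp at hneg
  have hmem : ∀ y, y ∈ (B m).roots.toFinset ↔ (B m).IsRoot y := by
    intro y
    rw [Multiset.mem_toFinset, Polynomial.mem_roots hne]
  have hroot : (B m).IsRoot r := hr0
  have hne' : (B m).roots.toFinset.Nonempty := ⟨r, (hmem r).mpr hroot⟩
  have hA := (hmem _).mp (Finset.max'_mem _ hne')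
  refine ⟨(B m).roots.toFinset.max' hne', hA,
    fun y hy => Finset.le_max' _ _ ((hmem y).mpr hy), ?_, ?_⟩
  · exact lt_of_lt_of_le (lt_of_lt_of_le hb hr.1) (Finset.le_max' _ _ ((hmem r).mpr hroot))
  · by_contra h
    have := hpos _ (not_lt.mp h)
    rw [hA] at this
    exact lt_irrefl _ this
end

section
/- There exists a threshold M such that for every integer m > M the number 𝐍(m) of real roots of the Bernoulli polynomial B_m satisfies 2m/(πe) − (2/(πe) + 2) < 𝐍(m) < 2m/(πe) + log m + (4πe + 3 − 4/(πe)). -/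
open Real

theorem bf_add_one (n : ℕ) (x : ℝ) :
    bernoulliFun n (x + 1) = bernoulliFun n x + n * x ^ (n - 1) := by
  have := congr_arg (·.aeval x) (Polynomial.bernoulli_comp_one_add_X n)
  simpa [bernoulliFun, Polynomial.aeval_comp, add_comm] using this

theorem bern_pow (n : ℕ) (a : ℝ) (ha : 0 ≤ a) :
    n * a ^ (n - 1) + a ^ n ≤ (a + 1) ^ n := by
  rcases n with _ | n
  · simp
  have h : ∀ n : ℕ, ((n + 1 : ℕ) : ℝ) * a ^ n + a ^ (n + 1) ≤ (a + 1) ^ (n + 1) := by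
    intro n
    induction n with
    | zero => simp [add_comm]
    | succ n ih =>
      have h1 := mul_le_mul_of_nonneg_right ih (by linarith : (0 : ℝ) ≤ a + 1)
      rw [← pow_succ] at h1
      refine le_trans ?_ h1
      have : (0 : ℝ) ≤ (n + 1 : ℕ) * a ^ n := by positivity
      push_cast at *
      have e : a ^ (n + 1) = a ^ n * a := pow_succ _ _
      have e2 : a ^ (n + 1 + 1) = a ^ n * a * a := by rw [pow_succ, pow_succ]
      rw [e2, e]
      nlinarith
  simpa using h n

theorem bf_nat_bounds (n k : ℕ) (y : ℝ) (hy : 0 ≤ y) :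
    bernoulliFun n y ≤ bernoulliFun n (y + k) ∧
      bernoulliFun n (y + k) ≤ bernoulliFun n y + (y + k) ^ n := by
  induction k with
  | zero => simp; positivity
  | succ k ih =>
    have h1 := bf_add_one n (y + k)
    have h2 := bern_pow n (y + k) (by positivity)
    have h3 : (0 : ℝ) ≤ n * (y + k) ^ (n - 1) := by positivity
    push_cast
    rw [← add_assoc]
    constructor <;> linarith [ih.1, ih.2]

noncomputable def gg (n : ℕ) (x : ℝ) : ℝ := (2 * π) ^ n / (2 * (n.factorial : ℝ)) * bernoulliFun n x

theorem fourier_tail (k : ℕ) (hk : 2 ≤ k) (x : ℝ) (hx : x ∈ Set.Icc (0 : ℝ) 1) :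
    |gg k x + cos (2 * π * x - k * (π / 2))| ≤ 8 / 2 ^ k := by
  have H := hasSum_one_div_nat_pow_mul_fourier hk hx
  have H2 := (hasSum_nat_add_iff' 2).mpr H
  have Z := (hasSum_nat_add_iff' 2).mpr hasSum_zeta_two
  have Z2 := Z.mul_left (8 / 2 ^ k)
  have N := H2.norm_le_of_bounded Z2 (by
    intro i
    rw [norm_mul]
    have h1 : ‖(fourier ((i + 2 : ℕ) : ℤ) (x : UnitAddCircle) + (-1 : ℂ) ^ k * fourier (-((i + 2 : ℕ) : ℤ)) (x : UnitAddCircle))‖ ≤ 2 := by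
      refine (norm_add_le _ _).trans ?_
      rw [norm_mul]
      simp only [fourier_apply, Circle.norm_coe, norm_pow, norm_neg, norm_one, one_pow]
      norm_num
    have h2 : ‖(1 : ℂ) / ((i + 2 : ℕ) : ℂ) ^ k‖ ≤ 4 / 2 ^ k * (1 / ((i + 2 : ℕ) : ℝ) ^ 2) := by
      rw [norm_div, norm_pow, Complex.norm_natCast, norm_one]
      obtain ⟨j, rfl⟩ := Nat.exists_eq_add_of_le hk
      have : (2 : ℝ) ^ j ≤ ((i + 2 : ℕ) : ℝ) ^ j := by
        gcongr; push_cast; linarith [(Nat.cast_nonneg i : (0 : ℝ) ≤ i)]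
      rw [pow_add, pow_add]
      have e : (4 : ℝ) / (2 ^ 2 * 2 ^ j) * (1 / ((i + 2 : ℕ) : ℝ) ^ 2) = 1 / (((i + 2 : ℕ) : ℝ) ^ 2 * 2 ^ j) := by
        have : ((i + 2 : ℕ) : ℝ) ≠ 0 := by positivity
        field_simp; norm_num
      rw [e]
      gcongr
    calc _ ≤ (4 / 2 ^ k * (1 / ((i + 2 : ℕ) : ℝ) ^ 2)) * 2 := by gcongr
      _ = _ := by ring)
  have hpi : π ^ 2 / 6 - ∑ i ∈ Finset.range 2, 1 / (i : ℝ) ^ 2 ≤ 2 := by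
    simp [Finset.sum_range_succ]
    nlinarith [pi_pos, pi_lt_d2]
  have hN : (8 : ℝ) / 2 ^ k * (π ^ 2 / 6 - ∑ i ∈ Finset.range 2, 1 / (i : ℝ) ^ 2) ≤ 8 / 2 ^ k * 2 := by
    gcongr
  have N3 := N.trans hN
  -- identify
  have key : (-(2 * π * Complex.I) ^ k / (k.factorial : ℂ) * bernoulliFun k x -
      ∑ i ∈ Finset.range 2, (1 : ℂ) / (i : ℂ) ^ k * (fourier i (x : UnitAddCircle) + (-1 : ℂ) ^ k * fourier (-i) (x : UnitAddCircle)))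
      = - 2 * Complex.I ^ k * ((gg k x + cos (2 * π * x - k * (π / 2)) : ℝ) : ℂ) := by
    have hI : Complex.I ^ k = Complex.exp (k * (π / 2) * Complex.I) := by
      rw [mul_assoc, Complex.exp_nat_mul, Complex.exp_pi_div_two_mul_I]
    have hk0 : k ≠ 0 := by omega
    have hm1 : (-1 : ℂ) ^ k = Complex.I ^ k * Complex.I ^ k := by
      rw [← mul_pow, Complex.I_mul_I]
    simp only [Finset.sum_range_succ, Finset.range_zero, Finset.sum_empty, fourier_coe_apply]
    simp only [gg, Complex.ofReal_add, Complex.ofReal_cos, Complex.cos]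
    rw [hm1]
    push_cast
    rw [show (-(2 * (π : ℂ) * x - k * (π / 2)) * Complex.I) = k * (π / 2) * Complex.I - 2 * π * x * Complex.I by ring,
      show ((2 * (π : ℂ) * x - k * (π / 2)) * Complex.I) = 2 * π * x * Complex.I - k * (π / 2) * Complex.I by ring,
      Complex.exp_sub, Complex.exp_sub, ← hI, mul_pow _ Complex.I]
    have hIk : Complex.I ^ k ≠ 0 := pow_ne_zero _ Complex.I_ne_zero
    have e1 : Complex.exp (2 * π * Complex.I * (1 : ℤ) * x / 1) = Complex.exp (2 * π * x * Complex.I) := by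
      congr 1; push_cast; ring
    have e2 : Complex.exp (2 * π * Complex.I * (-1 : ℤ) * x / 1) = (Complex.exp (2 * π * x * Complex.I))⁻¹ := by
      rw [← Complex.exp_neg]; congr 1; push_cast; ring
    simp [hk0] at e1 e2 ⊢
    rw [e1, e2]
    have hE : Complex.exp (2 * π * x * Complex.I) ≠ 0 := Complex.exp_ne_zero _
    have hF : (k.factorial : ℂ) ≠ 0 := by exact_mod_cast k.factorial_ne_zero
    field_simp
    ring
  rw [key] at N3
  simp only [norm_mul, norm_neg, norm_pow, Complex.norm_I, one_pow, Complex.norm_real, Real.norm_eq_abs] at N3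
  norm_num at N3
  have : (8 : ℝ) / 2 ^ k * 2 = 2 * (8 / 2 ^ k) := by ring
  linarith

theorem gg_approx (n : ℕ) (hn : 2 ≤ n) (x : ℝ) (hx : 0 ≤ x) :
    |gg n x + cos (2 * π * x - n * (π / 2))| ≤ 8 / 2 ^ n + (2 * π * x) ^ n / (2 * (n.factorial : ℝ)) := by
  have hf : 0 ≤ Int.fract x := Int.fract_nonneg x
  have h1 := fourier_tail n hn (Int.fract x) ⟨hf, (Int.fract_lt_one x).le⟩
  obtain ⟨h2, h3⟩ := bf_nat_bounds n ⌊x⌋₊ (Int.fract x) hf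
  have hx' : Int.fract x + (⌊x⌋₊ : ℝ) = x := by
    rw [natCast_floor_eq_intCast_floor hx]; exact Int.fract_add_floor x
  rw [hx'] at h2 h3
  have hc : cos (2 * π * x - n * (π / 2)) = cos (2 * π * Int.fract x - n * (π / 2)) := by
    rw [← cos_add_nat_mul_two_pi (2 * π * Int.fract x - n * (π / 2)) ⌊x⌋₊]
    congr 1
    nth_rw 1 [← hx']; ring
  have hc0 : 0 ≤ (2 * π) ^ n / (2 * (n.factorial : ℝ)) := by positivity
  have h4 := mul_le_mul_of_nonneg_left h2 hc0
  have h5 := mul_le_mul_of_nonneg_left h3 hc0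
  have e : (2 * π) ^ n / (2 * (n.factorial : ℝ)) * x ^ n = (2 * π * x) ^ n / (2 * (n.factorial : ℝ)) := by
    rw [mul_pow (2 * π) x]; ring
  have hp : 0 ≤ (2 * π * x) ^ n / (2 * (n.factorial : ℝ)) := by positivity
  rw [mul_add, e] at h5
  rw [hc]
  unfold gg at *
  rw [abs_le] at *
  constructor <;> linarith [h1.1, h1.2]

theorem gg_lower (n : ℕ) (hn : 2 ≤ n) (x : ℝ) (hx : 1 ≤ x) :
    (2 * π) ^ n / (2 * (n.factorial : ℝ)) * (n * (x - 1) ^ (n - 1)) - 1 - 8 / 2 ^ n ≤ gg n x := by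
  have h1 := bf_add_one n (x - 1)
  rw [sub_add_cancel] at h1
  have h0 : 0 ≤ x - 1 := by linarith
  have hf : 0 ≤ Int.fract (x - 1) := Int.fract_nonneg _
  have h2 := (bf_nat_bounds n ⌊x - 1⌋₊ (Int.fract (x - 1)) hf).1
  have hx' : Int.fract (x - 1) + (⌊x - 1⌋₊ : ℝ) = x - 1 := by
    rw [natCast_floor_eq_intCast_floor h0]; exact Int.fract_add_floor _
  rw [hx'] at h2
  have h3 := fourier_tail n hn (Int.fract (x - 1)) ⟨hf, (Int.fract_lt_one _).le⟩
  have hc0 : 0 ≤ (2 * π) ^ n / (2 * (n.factorial : ℝ)) := by positivity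
  have h4 := mul_le_mul_of_nonneg_left h2 hc0
  have h5 := cos_le_one (2 * π * Int.fract (x - 1) - n * (π / 2))
  unfold gg at *
  rw [h1, mul_add]
  rw [abs_le] at h3
  linarith [h3.1]

theorem sqrt_exp (n : ℕ) (hn : 1 ≤ n) : √(n : ℝ) = exp (log n / 2) := by
  have h : (0 : ℝ) < n := by exact_mod_cast hn
  rw [Real.exp_half, exp_log h]

theorem small_asymp (C : ℝ) : ∃ N : ℕ, ∀ n : ℕ, N ≤ n → ∀ x : ℝ, 0 ≤ x →
    2 * π * exp 1 * x ≤ n + 2 / 5 * log n + C →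
    (2 * π * x) ^ n / (2 * (n.factorial : ℝ)) ≤ 1 / 8 := by
  have hl : Filter.Tendsto (fun n : ℕ => log (n : ℝ)) Filter.atTop Filter.atTop :=
    tendsto_log_atTop.comp tendsto_natCast_atTop_atTop
  obtain ⟨N, hN⟩ := Filter.eventually_atTop.mp (hl.eventually_ge_atTop (10 * (C + log 4)))
  refine ⟨max N 1, fun n hn x hx h => ?_⟩
  have hn1 : 1 ≤ n := le_of_max_le_right hn
  have hlog := hN n (le_of_max_le_left hn)
  have hn0 : (0 : ℝ) < n := by exact_mod_cast hn1
  set u : ℝ := 2 / 5 * log n + C with hu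
  have he := exp_pos 1
  have h1 : 2 * π * x ≤ n / exp 1 * exp (u / n) := by
    have h2 : u / n + 1 ≤ exp (u / n) := add_one_le_exp _
    have h3 : (n : ℝ) * (u / n + 1) = u + n := by field_simp
    have h4 : (n : ℝ) * (u / n + 1) ≤ n * exp (u / n) := by gcongr
    rw [div_mul_eq_mul_div, le_div_iff₀ he]
    nlinarith
  have h2 : (2 * π * x) ^ n ≤ (n / exp 1) ^ n * exp u := by
    calc (2 * π * x) ^ n ≤ (n / exp 1 * exp (u / n)) ^ n := by gcongr
      _ = _ := by
        rw [mul_pow, ← exp_nat_mul]; congr 2; field_simp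
  have h3 := Stirling.le_factorial_stirling n
  have h4 : √(n : ℝ) ≤ √(2 * π * n) := by
    apply Real.sqrt_le_sqrt
    nlinarith [pi_gt_three]
  have h5 : 4 * exp u ≤ √(n : ℝ) := by
    rw [sqrt_exp n hn1]
    have : (4 : ℝ) = exp (log 4) := (exp_log (by norm_num)).symm
    rw [this, ← exp_add, exp_le_exp]
    linarith
  have hp : 0 < ((n : ℝ) / exp 1) ^ n := by positivity
  have hf : (0 : ℝ) < n.factorial := by exact_mod_cast n.factorial_pos
  rw [div_le_iff₀ (by positivity)]
  have h6 : (4 * exp u) * (n / exp 1) ^ n ≤ n.factorial := by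
    refine le_trans ?_ h3
    gcongr
    exact h5.trans h4
  linarith

theorem fact_upper (n : ℕ) (hn : 1 ≤ n) :
    (n.factorial : ℝ) ≤ exp 1 * √(n : ℝ) * (n / exp 1) ^ n := by
  obtain ⟨k, rfl⟩ := Nat.exists_eq_add_of_le' hn
  have h := Stirling.stirlingSeq'_antitone (Nat.zero_le k)
  have hn0 : (0 : ℝ) < (k + 1 : ℕ) := by positivity
  simp only [Function.comp, Nat.succ_eq_add_one, zero_add, Stirling.stirlingSeq_one] at h
  rw [Stirling.stirlingSeq, div_le_iff₀ (by positivity)] at h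
  refine h.trans (le_of_eq ?_)
  rw [Real.sqrt_mul (by norm_num)]
  have : √(2 : ℝ) ≠ 0 := by positivity
  field_simp

theorem large_asymp : ∃ N : ℕ, ∀ n : ℕ, N ≤ n → ∀ x : ℝ,
    n + 3 / 5 * log n ≤ 2 * π * exp 1 * (x - 1) → 0 < gg n x := by
  have hl : ∀ᶠ n : ℕ in Filter.atTop, log (n : ℝ) ≤ 1 / 6 * n := by
    have := (Real.isLittleO_log_id_atTop.comp_tendsto
      (tendsto_natCast_atTop_atTop (R := ℝ))).bound (show (0 : ℝ) < 1 / 6 by norm_num)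
    filter_upwards [this] with n hn
    simp only [Function.comp, id, Real.norm_eq_abs, Nat.abs_cast] at hn
    exact (le_abs_self _).trans hn
  obtain ⟨N, hN⟩ := Filter.eventually_atTop.mp hl
  refine ⟨max N 20, fun n hn x h => ?_⟩
  have hn20 : 20 ≤ n := le_of_max_le_right hn
  have hn1 : 1 ≤ n := by omega
  have hlog := hN n (le_of_max_le_left hn)
  have hn0 : (20 : ℝ) ≤ n := by exact_mod_cast hn20
  have hlog0 : 0 ≤ log (n : ℝ) := log_nonneg (by linarith)
  have he := exp_pos 1
  have hpi := pi_pos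
  have hx : 0 < x - 1 := by
    by_contra hx
    have : 2 * π * exp 1 * (x - 1) ≤ 0 := mul_nonpos_of_nonneg_of_nonpos (by positivity) (by linarith)
    linarith
  have hg := gg_lower n (by omega) x (by linarith)
  have h2n : (8 : ℝ) / 2 ^ n ≤ 1 := by
    rw [div_le_one (by positivity)]
    calc (8 : ℝ) = 2 ^ 3 := by norm_num
      _ ≤ 2 ^ n := pow_le_pow_right₀ (by norm_num) (by omega)
  set t : ℝ := 3 / 5 * log n / n with ht
  have ht0 : 0 ≤ t := by positivity
  have h1 : n / exp 1 * (1 + t) ≤ 2 * π * (x - 1) := by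
    have : (n : ℝ) * (1 + t) = n + 3 / 5 * log n := by rw [ht]; field_simp
    rw [div_mul_eq_mul_div, div_le_iff₀ he, this]
    linarith
  have h2 : exp (t / (1 + t)) ≤ 1 + t := by
    have h3 : -(t / (1 + t)) + 1 ≤ exp (-(t / (1 + t))) := add_one_le_exp _
    have h4 : -(t / (1 + t)) + 1 = (1 + t)⁻¹ := by field_simp; ring
    rw [h4, exp_neg] at h3
    exact (inv_le_inv₀ (by positivity) (by positivity)).mp h3
  have h3 : √(n : ℝ) ≤ (1 + t) ^ (n - 1) := by
    refine le_trans ?_ (pow_le_pow_left₀ (exp_pos _).le h2 _)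
    rw [sqrt_exp n hn1, ← exp_nat_mul, exp_le_exp, Nat.cast_sub hn1]
    have : t / (1 + t) = 3 / 5 * log n / (n + 3 / 5 * log n) := by
      rw [ht]; field_simp
    rw [this, ← mul_div_assoc, div_le_div_iff₀ (by norm_num) (by linarith)]
    push_cast
    nlinarith
  have h4 : (2 * π) ^ n * (n * (x - 1) ^ (n - 1)) ≥ 2 * π * exp 1 * ((n / exp 1) ^ n * √(n : ℝ)) := by
    obtain ⟨k, rfl⟩ := Nat.exists_eq_add_of_le' hn1
    simp only [Nat.add_sub_cancel] at *
    have e1 : (2 * π) ^ (k + 1) * (((k + 1 : ℕ) : ℝ) * (x - 1) ^ k) = 2 * π * (k + 1 : ℕ) * (2 * π * (x - 1)) ^ k := by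
      rw [mul_pow (2 * π) (x - 1), pow_succ]; ring
    have e2 : 2 * π * exp 1 * ((((k + 1 : ℕ) : ℝ) / exp 1) ^ (k + 1) * √((k + 1 : ℕ) : ℝ)) = 2 * π * (k + 1 : ℕ) * ((((k + 1 : ℕ) : ℝ) / exp 1) ^ k * √((k + 1 : ℕ) : ℝ)) := by
      rw [pow_succ]; field_simp
    rw [e1, e2, ge_iff_le]
    gcongr
    refine le_trans ?_ (pow_le_pow_left₀ (by positivity) h1 k)
    rw [mul_pow]
    gcongr
  have h5 := fact_upper n hn1
  have hf : (0 : ℝ) < n.factorial := by exact_mod_cast n.factorial_pos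
  have h6 : 3 ≤ (2 * π) ^ n / (2 * (n.factorial : ℝ)) * (n * (x - 1) ^ (n - 1)) := by
    rw [div_mul_eq_mul_div, le_div_iff₀ (by positivity)]
    have h7 : 3 * (2 * (n.factorial : ℝ)) ≤ 2 * π * (n.factorial : ℝ) := by
      nlinarith [pi_gt_three]
    have h8 : 2 * π * (n.factorial : ℝ) ≤ 2 * π * (exp 1 * √(n : ℝ) * (n / exp 1) ^ n) := by gcongr
    linarith
  linarith

theorem B_ne_zero (m : ℕ) : B m ≠ 0 := by
  intro h
  have h1 : (B m).coeff m = 1 := by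
    simp [B, Polynomial.coeff_bernoulli]
  rw [h] at h1
  simp at h1

noncomputable def rts (m : ℕ) : Finset ℝ := (B m).roots.toFinset

theorem mem_rts (m : ℕ) (x : ℝ) : x ∈ rts m ↔ bernoulliFun m x = 0 := by
  simp only [rts, Multiset.mem_toFinset, Polynomial.mem_roots (B_ne_zero m), Polynomial.IsRoot.def]
  rfl

theorem ncard_rts (m : ℕ) : {x : ℝ | (B m).IsRoot x}.ncard = (rts m).card := by
  rw [← Set.ncard_coe_finset]
  congr 1
  ext x
  simp [rts, Polynomial.mem_roots (B_ne_zero m)]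

theorem bf_rolle (m : ℕ) (hm : 1 ≤ m) (x y : ℝ) (hxy : x < y) (hx : bernoulliFun m x = 0)
    (hy : bernoulliFun m y = 0) : ∃ z, x < z ∧ z < y ∧ bernoulliFun (m - 1) z = 0 := by
  obtain ⟨z, hz, h⟩ := exists_hasDerivAt_eq_zero hxy
    (continuous_bernoulliFun m).continuousOn (hx.trans hy.symm)
    (fun z _ => hasDerivAt_bernoulliFun m z)
  refine ⟨z, hz.1, hz.2, ?_⟩
  have : (m : ℝ) ≠ 0 := Nat.cast_ne_zero.mpr (by omega)
  exact (mul_eq_zero.mp h).resolve_left this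

theorem count_right (m : ℕ) (a : ℝ) (h : ∀ x, a < x → bernoulliFun m x ≠ 0) (j : ℕ) :
    ((rts (m + j)).filter (fun x => a < x)).card ≤ j := by
  induction j with
  | zero =>
    simp only [Nat.le_zero, Finset.card_eq_zero, Finset.filter_eq_empty_iff]
    intro x hx hax
    exact h x hax ((mem_rts _ _).mp hx)
  | succ j ih =>
    refine le_trans (Finset.card_le_of_interleaved
      (t := (rts (m + j)).filter (fun x => a < x)) ?_) (Nat.add_le_add_right ih 1)
    intro x hx y hy hxy _
    simp only [Finset.mem_filter, mem_rts] at hx hy ⊢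
    obtain ⟨z, h1, h2, h3⟩ := bf_rolle (m + (j + 1)) (by omega) x y hxy hx.1 hy.1
    exact ⟨z, ⟨h3, hx.2.trans h1⟩, h1, h2⟩

theorem count_mid (m : ℕ) (hm : 1 ≤ m) (X : ℝ) (hX : 1 / 2 ≤ X)
    (h1 : ∀ x, 0 ≤ x → x ≤ X → |gg m x + cos (2 * π * x - m * (π / 2))| ≤ 1 / 4)
    (h2 : ∀ x, 0 ≤ x → x ≤ X → |gg (m - 1) x + cos (2 * π * x - (m - 1 : ℕ) * (π / 2))| ≤ 1 / 4) :
    (((rts m).filter (fun x => 1 / 2 ≤ x ∧ x ≤ X)).card : ℝ) ≤ 2 * X + 1 := by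
  have hinj : ∀ x y : ℝ, 1 / 2 ≤ x → x < y → y ≤ X → bernoulliFun m x = 0 → bernoulliFun m y = 0 →
      ⌊2 * x - m / 2⌋ = ⌊2 * y - m / 2⌋ → False := by
    intro x y hx hxy hy bx bY hfl
    obtain ⟨z, hxz, hzy, bz⟩ := bf_rolle m hm x y hxy bx bY
    set n := ⌊2 * x - m / 2⌋ with hn
    have f1 : (n : ℝ) ≤ 2 * x - m / 2 := Int.floor_le _
    have f2 : 2 * y - m / 2 < n + 1 := by rw [hfl]; exact Int.lt_floor_add_one _
    have a1 := h1 x (by linarith) (by linarith)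
    have a2 := h1 y (by linarith) (by linarith)
    have a3 := h2 z (by linarith) (by linarith)
    have e3 : cos (2 * π * z - (m - 1 : ℕ) * (π / 2)) = - sin (2 * π * z - m * (π / 2)) := by
      rw [Nat.cast_sub hm, ← cos_add_pi_div_two]; congr 1; push_cast; ring
    rw [e3] at a3
    simp only [gg, bx, bY, bz, mul_zero, zero_add, abs_neg] at a1 a2 a3
    have conv : ∀ w : ℝ, 2 * π * w - m * (π / 2) = π * (2 * w - m / 2 - n) + n * π := by
      intro w; ring
    rw [conv, cos_add_int_mul_pi, abs_mul, abs_neg_one_zpow, one_mul] at a1 a2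
    rw [conv, sin_add_int_mul_pi, abs_mul, abs_neg_one_zpow, one_mul] at a3
    have hpi := pi_pos
    have c1 : cos (π * (2 * z - m / 2 - n)) ≤ cos (π * (2 * x - m / 2 - n)) := by
      apply cos_le_cos_of_nonneg_of_le_pi
      · exact mul_nonneg hpi.le (by linarith)
      · nlinarith
      · gcongr
    have c2 : cos (π * (2 * y - m / 2 - n)) ≤ cos (π * (2 * z - m / 2 - n)) := by
      apply cos_le_cos_of_nonneg_of_le_pi
      · exact mul_nonneg hpi.le (by linarith)
      · nlinarith
      · gcongr
    rw [abs_le] at a1 a2 a3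
    have := sin_sq_add_cos_sq (π * (2 * z - m / 2 - n))
    nlinarith [a1.1, a1.2, a2.1, a2.2, a3.1, a3.2]
  have hcard : ((rts m).filter (fun x => 1 / 2 ≤ x ∧ x ≤ X)).card ≤
      (Finset.Icc ⌊1 - (m : ℝ) / 2⌋ ⌊2 * X - m / 2⌋).card := by
    apply Finset.card_le_card_of_injOn (fun x : ℝ => ⌊2 * x - (m : ℝ) / 2⌋)
    · intro x hx
      simp only [Finset.coe_filter, Set.mem_ofPred_eq] at hx
      simp only [Finset.coe_Icc, Set.mem_Icc]
      constructor <;> apply Int.floor_le_floor <;> linarith [hx.2.1, hx.2.2]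
    · intro x hx y hy hxy
      simp only [Finset.coe_filter, Set.mem_ofPred_eq, mem_rts] at hx hy
      rcases lt_trichotomy x y with h | h | h
      · exact (hinj x y hx.2.1 h hy.2.2 hx.1 hy.1 hxy).elim
      · exact h
      · exact (hinj y x hy.2.1 h hx.2.2 hy.1 hx.1 hxy.symm).elim
  rw [Int.card_Icc] at hcard
  have hle : ⌊1 - (m : ℝ) / 2⌋ ≤ ⌊2 * X - m / 2⌋ := Int.floor_le_floor (by linarith)
  have hc : (((rts m).filter (fun x => 1 / 2 ≤ x ∧ x ≤ X)).card : ℤ) ≤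
      ⌊2 * X - m / 2⌋ + 1 - ⌊1 - (m : ℝ) / 2⌋ := by omega
  have hc' : (((rts m).filter (fun x => 1 / 2 ≤ x ∧ x ≤ X)).card : ℝ) ≤
      ⌊2 * X - m / 2⌋ + 1 - ⌊1 - (m : ℝ) / 2⌋ := by exact_mod_cast hc
  linarith [Int.floor_le (2 * X - m / 2), Int.lt_floor_add_one (1 - (m : ℝ) / 2)]

theorem count_low (m : ℕ) (X : ℝ)
    (h1 : ∀ x, 0 ≤ x → x ≤ X → |gg m x + cos (2 * π * x - m * (π / 2))| ≤ 1 / 4) :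
    2 * X - 3 ≤ (((rts m).filter (fun x => 1 / 2 < x)).card : ℝ) := by
  set S := Finset.Icc ⌈1 - (m : ℝ) / 2⌉ ⌊2 * X - 1 - m / 2⌋ with hS
  have hval : ∀ n : ℤ, 0 ≤ (n : ℝ) / 2 + m / 4 → (n : ℝ) / 2 + m / 4 ≤ X →
      |gg m ((n : ℝ) / 2 + m / 4) + (-1) ^ n| ≤ 1 / 4 := by
    intro n hn hn'
    have := h1 _ hn hn'
    rw [show 2 * π * ((n : ℝ) / 2 + m / 4) - m * (π / 2) = n * π by ring, cos_int_mul_pi] at this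
    exact this
  have hcont : Continuous (gg m) := by
    unfold gg
    exact continuous_const.mul (continuous_bernoulliFun m)
  have hroot : ∀ n : ℤ, n ∈ S → ∃ x, (n : ℝ) / 2 + m / 4 < x ∧ x < ((n : ℝ) + 1) / 2 + m / 4 ∧
      bernoulliFun m x = 0 := by
    intro n hn
    rw [hS, Finset.mem_Icc, Int.ceil_le, Int.le_floor] at hn
    obtain ⟨g1, g2⟩ := hn
    have v1 := hval n (by linarith) (by linarith)
    have v2 := hval (n + 1) (by push_cast; linarith) (by push_cast; linarith)
    push_cast at v2
    rw [zpow_add₀ (by norm_num), zpow_one] at v2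
    have hlt : (n : ℝ) / 2 + m / 4 < ((n : ℝ) + 1) / 2 + m / 4 := by linarith
    have hz : ∃ x ∈ Set.Ioo ((n : ℝ) / 2 + m / 4) (((n : ℝ) + 1) / 2 + m / 4), gg m x = 0 := by
      rcases Int.even_or_odd n with he | ho
      · rw [he.neg_one_zpow] at v1 v2
        rw [abs_le] at v1 v2
        exact intermediate_value_Ioo hlt.le hcont.continuousOn
          ⟨by linarith [v1.2], by linarith [v2.1]⟩
      · rw [ho.neg_one_zpow] at v1 v2
        rw [abs_le] at v1 v2
        exact intermediate_value_Ioo' hlt.le hcont.continuousOn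
          ⟨by linarith [v2.2], by linarith [v1.1]⟩
    obtain ⟨x, hx, h0⟩ := hz
    refine ⟨x, hx.1, hx.2, ?_⟩
    unfold gg at h0
    refine (mul_eq_zero.mp h0).resolve_left ?_
    have := pi_pos
    positivity
  choose! r hr1 hr2 hr3 using hroot
  have hcard : S.card ≤ ((rts m).filter (fun x => 1 / 2 < x)).card := by
    apply Finset.card_le_card_of_injOn r
    · intro n hn
      have hn' : n ∈ S := hn
      simp only [Finset.coe_filter, Set.mem_ofPred_eq, mem_rts]
      refine ⟨hr3 n hn', lt_of_le_of_lt ?_ (hr1 n hn')⟩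
      rw [hS, Finset.mem_Icc, Int.ceil_le] at hn'
      linarith [hn'.1]
    · intro n hn k hk hnk
      have hn' : n ∈ S := hn
      have hk' : k ∈ S := hk
      have i1 := hr1 n hn'
      have i2 := hr2 n hn'
      have i3 := hr1 k hk'
      have i4 := hr2 k hk'
      rw [hnk] at i1 i2
      have j1 : (n : ℝ) < k + 1 := by linarith
      have j2 : (k : ℝ) < n + 1 := by linarith
      have j3 : n < k + 1 := by exact_mod_cast j1
      have j4 : k < n + 1 := by exact_mod_cast j2
      omega
  have hc : ⌊2 * X - 1 - m / 2⌋ + 1 - ⌈1 - (m : ℝ) / 2⌉ ≤ (S.card : ℤ) := by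
    rw [hS, Int.card_Icc]; omega
  have hc' : (⌊2 * X - 1 - m / 2⌋ : ℝ) + 1 - ⌈1 - (m : ℝ) / 2⌉ ≤ (S.card : ℝ) := by exact_mod_cast hc
  have hcr : (S.card : ℝ) ≤ (((rts m).filter (fun x => 1 / 2 < x)).card : ℝ) := by exact_mod_cast hcard
  linarith [Int.lt_floor_add_one (2 * X - 1 - m / 2), Int.ceil_lt_add_one (1 - (m : ℝ) / 2)]

theorem rts_refl (m : ℕ) (x : ℝ) (h : x ∈ rts m) : 1 - x ∈ rts m := by
  rw [mem_rts] at *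
  rw [bernoulliFun_eval_one_sub, h, mul_zero]

theorem double_low (m : ℕ) : 2 * ((rts m).filter (fun x => 1 / 2 < x)).card ≤ (rts m).card := by
  set R := (rts m).filter (fun x => 1 / 2 < x) with hR
  have hd : Disjoint R (R.image (fun x => 1 - x)) := by
    rw [Finset.disjoint_left]
    intro x hx hx'
    obtain ⟨y, hy, rfl⟩ := Finset.mem_image.mp hx'
    have h1 := (Finset.mem_filter.mp hx).2
    have h2 := (Finset.mem_filter.mp hy).2
    linarith
  have hc : (R.image (fun x => 1 - x)).card = R.card :=
    Finset.card_image_of_injective _ sub_right_injective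
  have hs : R ∪ R.image (fun x => 1 - x) ⊆ rts m := by
    apply Finset.union_subset (Finset.filter_subset _ _)
    intro x hx
    obtain ⟨y, hy, rfl⟩ := Finset.mem_image.mp hx
    exact rts_refl m y (Finset.mem_filter.mp hy).1
  have := Finset.card_le_card hs
  rw [Finset.card_union_of_disjoint hd, hc] at this
  omega

theorem double_up (m : ℕ) (X : ℝ) : (rts m).card ≤
    2 * (((rts m).filter (fun x => 1 / 2 ≤ x ∧ x ≤ X)).card +
      ((rts m).filter (fun x => X < x)).card) := by
  set R := (rts m).filter (fun x => 1 / 2 ≤ x ∧ x ≤ X) ∪ (rts m).filter (fun x => X < x) with hR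
  have hRm : ∀ x, x ∈ rts m → 1 / 2 ≤ x → x ∈ R := by
    intro x hx hx'
    rw [hR, Finset.mem_union, Finset.mem_filter, Finset.mem_filter]
    rcases le_or_gt x X with h | h
    · exact Or.inl ⟨hx, hx', h⟩
    · exact Or.inr ⟨hx, h⟩
  have hs : rts m ⊆ R ∪ R.image (fun x => 1 - x) := by
    intro x hx
    rw [Finset.mem_union]
    rcases le_or_gt (1 / 2) x with h | h
    · exact Or.inl (hRm x hx h)
    · exact Or.inr (Finset.mem_image.mpr ⟨1 - x, hRm _ (rts_refl m x hx) (by linarith), by ring⟩)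
  have h1 := Finset.card_le_card hs
  have h2 := Finset.card_union_le R (R.image (fun x => 1 - x))
  have h3 : (R.image (fun x => 1 - x)).card ≤ R.card := Finset.card_image_le
  have h4 : R.card ≤ _ := Finset.card_union_le _ _
  omega

theorem stmt_13 :
    ∃ M : ℕ, ∀ m : ℕ, M < m →
      2 * (m : ℝ) / (π * Real.exp 1) - (2 / (π * Real.exp 1) + 2) <
        ({x : ℝ | (B m).IsRoot x}.ncard : ℝ) ∧
      ({x : ℝ | (B m).IsRoot x}.ncard : ℝ) <
        2 * (m : ℝ) / (π * Real.exp 1) + Real.log m +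
          (4 * π * Real.exp 1 + 3 - 4 / (π * Real.exp 1)) := by
  obtain ⟨N1, hN1⟩ := small_asymp 2
  obtain ⟨N2, hN2⟩ := large_asymp
  have hl : Filter.Tendsto (fun n : ℕ => log (n : ℝ)) Filter.atTop Filter.atTop :=
    tendsto_log_atTop.comp tendsto_natCast_atTop_atTop
  obtain ⟨N3, hN3⟩ := Filter.eventually_atTop.mp (hl.eventually_ge_atTop 101)
  refine ⟨N1 + 2 * N2 + N3 + 100, fun m hm => ?_⟩
  have hlog := hN3 m (by omega)
  have he1 := exp_one_gt_d9
  have he2 := exp_one_lt_d9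
  have hp1 := pi_gt_three
  have hp2 := pi_lt_d2
  have hq1 : 8 < π * exp 1 := by nlinarith
  have hq2 : π * exp 1 < 9 := by nlinarith
  have hm100 : (100 : ℝ) < m := by exact_mod_cast (by omega : 100 < m)
  have hmlog : log (m : ℝ) ≤ m := (log_le_sub_one_of_pos (by linarith)).trans (by linarith)
  set X : ℝ := (m + 2 / 5 * log m) / (2 * π * exp 1) with hXdef
  have hXe : 2 * π * exp 1 * X = m + 2 / 5 * log m := by
    rw [hXdef]; field_simp
  have hXle : ∀ x, x ≤ X → 2 * π * exp 1 * x ≤ m + 2 / 5 * log m := by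
    intro x hx
    rw [← hXe]; gcongr
  have hX1 : 1 / 2 ≤ X := by
    rw [hXdef, le_div_iff₀ (by positivity)]
    nlinarith
  have h2n : ∀ n : ℕ, 6 ≤ n → (8 : ℝ) / 2 ^ n ≤ 1 / 8 := by
    intro n hn
    rw [div_le_iff₀ (by positivity)]
    have : (2 : ℝ) ^ 6 ≤ 2 ^ n := pow_le_pow_right₀ (by norm_num) hn
    linarith
  have h1 : ∀ x, 0 ≤ x → x ≤ X → |gg m x + cos (2 * π * x - m * (π / 2))| ≤ 1 / 4 := by
    intro x hx hxX
    have h3 := hN1 m (by omega) x hx (by linarith [hXle x hxX])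
    linarith [gg_approx m (by omega) x hx, h2n m (by omega)]
  have h2 : ∀ x, 0 ≤ x → x ≤ X → |gg (m - 1) x + cos (2 * π * x - (m - 1 : ℕ) * (π / 2))| ≤ 1 / 4 := by
    intro x hx hxX
    have hlm : log (m : ℝ) ≤ log ((m - 1 : ℕ) : ℝ) + 1 := by
      have hm1 : (0 : ℝ) < ((m - 1 : ℕ) : ℝ) := by exact_mod_cast (by omega : 0 < m - 1)
      have hle := log_mul hm1.ne' (exp_pos 1).ne'
      rw [log_exp] at hle
      rw [← hle]
      apply log_le_log (by linarith)
      rw [Nat.cast_sub (by omega)]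
      push_cast
      nlinarith
    have h3 := hN1 (m - 1) (by omega) x hx (by
      have := hXle x hxX
      have e : ((m - 1 : ℕ) : ℝ) = m - 1 := by rw [Nat.cast_sub (by omega)]; simp
      rw [e] at hlm ⊢
      linarith)
    linarith [gg_approx (m - 1) (by omega) x hx, h2n (m - 1) (by omega)]
  have hX4 : 4 * X = 2 * m / (π * exp 1) + 4 / 5 * (log m / (π * exp 1)) := by
    rw [hXdef]; field_simp; ring
  have hr1 : log (m : ℝ) / (π * exp 1) ≤ log m / 8 := by gcongr
  have hr2 : log (m : ℝ) / 9 ≤ log m / (π * exp 1) := by gcongr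
  have hs1 : 0 < 2 / (π * exp 1) := by positivity
  have hs2 : 4 / (π * exp 1) ≤ 4 / 8 := by gcongr
  rw [ncard_rts]
  constructor
  · have c1 := count_low m X h1
    have c2 : 2 * (((rts m).filter (fun x => 1 / 2 < x)).card : ℝ) ≤ ((rts m).card : ℝ) := by
      exact_mod_cast double_low m
    linarith
  · have c1 := count_mid m (by omega) X hX1 h1 h2
    set j := ⌈1 / 5 * log (m : ℝ) + 18⌉₊ with hj
    have hj1 : 1 / 5 * log (m : ℝ) + 18 ≤ j := Nat.le_ceil _
    have hj2 : (j : ℝ) < 1 / 5 * log (m : ℝ) + 18 + 1 := Nat.ceil_lt_add_one (by linarith)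
    have hjm : j + N2 ≤ m := by
      have : (2 * N2 + 100 : ℝ) < m := by exact_mod_cast (by omega : 2 * N2 + 100 < m)
      have : (j + N2 : ℝ) ≤ m := by linarith
      exact_mod_cast this
    have c2 := count_right (m - j) X (by
      intro x hx h0
      have hpos : 0 < gg (m - j) x := by
        apply hN2 (m - j) (by omega)
        have e : ((m - j : ℕ) : ℝ) = m - j := by rw [Nat.cast_sub (by omega)]
        have hXx : 2 * π * exp 1 * X ≤ 2 * π * exp 1 * x := by gcongr
        have hlog2 : log ((m - j : ℕ) : ℝ) ≤ log m := by
          rcases Nat.eq_zero_or_pos (m - j) with h | h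
          · rw [h]; simp; linarith
          · apply log_le_log (by exact_mod_cast h)
            exact_mod_cast Nat.sub_le _ _
        rw [e] at hlog2 ⊢
        linarith
      simp [gg, h0] at hpos) j
    rw [Nat.sub_add_cancel (by omega)] at c2
    have c2' : (((rts m).filter (fun x => X < x)).card : ℝ) ≤ j := by exact_mod_cast c2
    have c3 : ((rts m).card : ℝ) ≤ 2 * ((((rts m).filter (fun x => 1 / 2 ≤ x ∧ x ≤ X)).card : ℝ) +
      ((rts m).filter (fun x => X < x)).card) := by exact_mod_cast double_up m X
    linarith
end

section
/- (Inkeri) As m → ∞, 𝐍(m)/m tends to 2/(πe) and 𝐀(m)/m tends to 1/(2πe), where 𝐍(m) is the number of real roots of the m-th Bernoulli polynomial and 𝐀(m) is its largest real root (defined for m large enough that a real root exists). -/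
open Real

namespace Inkeri
open Filter Topology

/-- Normalised Bernoulli polynomial. -/
noncomputable def bb (m : ℕ) (x : ℝ) : ℝ :=
  bernoulliFun m x * ((2 * π) ^ m / (2 * (m.factorial : ℝ)))

lemma fourier_one_term (k : ℕ) (x : ℝ) :
    Complex.exp (2 * π * Complex.I * x) + (-1) ^ k * Complex.exp (-(2 * π * Complex.I * x)) =
      Complex.I ^ k * (2 * Complex.cos (2 * π * x - k * π / 2)) := by
  rw [Complex.two_cos]
  have e1 : Complex.exp ((2 * π * x - k * π / 2) * Complex.I) =
      Complex.exp (2 * π * Complex.I * x) * (-Complex.I) ^ k := by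
    rw [← Complex.exp_neg_pi_div_two_mul_I, ← Complex.exp_nat_mul, ← Complex.exp_add]
    congr 1; ring
  have e2 : Complex.exp (-(2 * π * x - k * π / 2) * Complex.I) =
      Complex.exp (-(2 * π * Complex.I * x)) * (Complex.I) ^ k := by
    have : Complex.I ^ k = Complex.exp (k * (π / 2 * Complex.I)) := by
      rw [Complex.exp_nat_mul, Complex.exp_pi_div_two_mul_I]
    rw [this, ← Complex.exp_add]
    congr 1; ring
  rw [e1, e2, mul_add]
  have h1 : Complex.I ^ k * (-Complex.I) ^ k = 1 := by
    rw [← mul_pow]; simp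
  have h2 : Complex.I ^ k * Complex.I ^ k = (-1) ^ k := by
    rw [← mul_pow]; simp
  linear_combination (-Complex.exp (2 * π * Complex.I * x)) * h1 -
    Complex.exp (-(2 * π * Complex.I * x)) * h2

lemma fourier_bound : ∃ C : ℝ, 0 ≤ C ∧ ∀ m : ℕ, 2 ≤ m → ∀ x ∈ Set.Icc (0:ℝ) 1,
    |bb m x + cos (2 * π * x - m * π / 2)| ≤ C / 2 ^ m := by
  have hs : Summable (fun n : ℕ => 1 / ((n:ℝ) + 2) ^ 2) := by
    have := (summable_nat_add_iff 2).2 (Real.summable_one_div_nat_pow.2 (le_refl 2))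
    simpa using this
  refine ⟨4 * ∑' n : ℕ, 1 / ((n:ℝ) + 2) ^ 2, ?_, ?_⟩
  · exact mul_nonneg (by norm_num) (tsum_nonneg fun n => by positivity)
  intro k hk x hx
  have h := hasSum_one_div_nat_pow_mul_fourier hk hx
  have h2 := (hasSum_nat_add_iff' 2).2 h
  have hb := (hs.hasSum).mul_left (8 / 2 ^ k)
  have hn := HasSum.norm_le_of_bounded h2 hb (by
    intro n
    rw [norm_mul]
    have a1 : ‖(fourier ((n + 2 : ℕ) : ℤ) (x : UnitAddCircle) +
        (-1 : ℂ) ^ k * fourier (-((n + 2 : ℕ) : ℤ)) (x : UnitAddCircle))‖ ≤ 2 := by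
      refine (norm_add_le _ _).trans ?_
      rw [norm_mul, norm_pow, norm_neg, norm_one, one_pow, one_mul]
      simp only [fourier_apply, Circle.norm_coe]
      norm_num
    have a2 : ‖(1 : ℂ) / ((n + 2 : ℕ) : ℂ) ^ k‖ ≤ 4 / 2 ^ k * (1 / ((n:ℝ) + 2) ^ 2) := by
      rw [norm_div, norm_pow, Complex.norm_natCast, norm_one]
      obtain ⟨j, rfl⟩ := Nat.exists_eq_add_of_le hk
      push_cast
      rw [div_mul_div_comm, mul_one, div_le_div_iff₀ (by positivity) (by positivity), pow_add, pow_add]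
      have : (2:ℝ) ^ j ≤ ((n:ℝ) + 2) ^ j := by
        gcongr; linarith [(Nat.cast_nonneg n : (0:ℝ) ≤ n)]
      nlinarith [this, sq_nonneg ((n:ℝ)+2)]
    calc _ ≤ (4 / 2 ^ k * (1 / ((n:ℝ) + 2) ^ 2)) * 2 := by gcongr
      _ = _ := by ring)
  have e : (-(2 * π * Complex.I) ^ k / (k.factorial : ℂ) * bernoulliFun k x -
      ∑ i ∈ Finset.range 2, (1 : ℂ) / (i : ℂ) ^ k * (fourier (i:ℤ) (x : UnitAddCircle)
        + (-1 : ℂ) ^ k * fourier (-(i:ℤ)) (x : UnitAddCircle))) =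
      Complex.I ^ k * (-2 : ℂ) * ((bb k x + cos (2 * π * x - k * π / 2) : ℝ) : ℂ) := by
    rw [Finset.sum_range_succ, Finset.sum_range_one]
    have := fourier_one_term k x
    simp only [fourier_coe_apply]
    push_cast
    rw [zero_pow (by omega)]
    simp only [div_zero, zero_mul, zero_add, one_pow, div_one, mul_one, one_mul]
    rw [show (2 * π * Complex.I * (-1) * x : ℂ) = -(2 * π * Complex.I * x) by ring, this, bb]
    push_cast
    have : (k.factorial : ℂ) ≠ 0 := by exact_mod_cast k.factorial_ne_zero
    rw [mul_pow]
    field_simp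
    ring
  rw [e, norm_mul, norm_mul, norm_pow, Complex.norm_I, Complex.norm_real, norm_neg,
    Complex.norm_ofNat, one_pow, one_mul, Real.norm_eq_abs] at hn
  calc _ ≤ (8 / 2 ^ k * ∑' n : ℕ, 1 / ((n:ℝ) + 2) ^ 2) / 2 := by linarith
    _ = _ := by ring

lemma bern_one_add (m : ℕ) (x : ℝ) :
    bernoulliFun m (x + 1) = bernoulliFun m x + m * x ^ (m - 1) := by
  have := congr_arg (·.aeval x) (Polynomial.bernoulli_comp_one_add_X m)
  rw [add_comm x 1]
  simpa [bernoulliFun, Polynomial.aeval_comp] using this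

lemma bern_add_nat (m : ℕ) (x : ℝ) (n : ℕ) :
    bernoulliFun m (x + n) = bernoulliFun m x + m * ∑ j ∈ Finset.range n, (x + j) ^ (m - 1) := by
  induction n with
  | zero => simp
  | succ n ih =>
    rw [Finset.sum_range_succ, Nat.cast_succ, ← add_assoc, bern_one_add, ih]; ring

/-- The coefficient of the power sums. -/
noncomputable def cc (m : ℕ) : ℝ := m * ((2 * π) ^ m / (2 * (m.factorial : ℝ)))

lemma cc_nonneg (m : ℕ) : 0 ≤ cc m := by unfold cc; positivity

lemma bb_add_nat (m : ℕ) (x : ℝ) (n : ℕ) :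
    bb m (x + n) = bb m x + cc m * ∑ j ∈ Finset.range n, (x + j) ^ (m - 1) := by
  unfold bb cc; rw [bern_add_nat]; ring

lemma cos_fract (m : ℕ) (x : ℝ) (n : ℕ) :
    cos (2 * π * (x + n) - m * π / 2) = cos (2 * π * x - m * π / 2) := by
  rw [← Real.cos_add_nat_mul_two_pi (2 * π * x - m * π / 2) n]
  congr 1; ring

lemma bb_upper : ∃ C : ℝ, 0 ≤ C ∧ ∀ m : ℕ, 2 ≤ m → ∀ x : ℝ, 0 ≤ x →
    |bb m x + cos (2 * π * x - m * π / 2)| ≤ C / 2 ^ m + cc m * x ^ m := by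
  obtain ⟨C, hC, h⟩ := fourier_bound
  refine ⟨C, hC, fun m hm x hx => ?_⟩
  have hy := h m hm (Int.fract x) ⟨Int.fract_nonneg x, (Int.fract_lt_one x).le⟩
  have hx' : Int.fract x + (⌊x⌋₊ : ℝ) = x := by
    rw [natCast_floor_eq_intCast_floor hx]; exact Int.fract_add_floor x
  have h1 := bb_add_nat m (Int.fract x) ⌊x⌋₊
  have h2 := cos_fract m (Int.fract x) ⌊x⌋₊
  rw [hx'] at h1 h2
  have hf := Int.fract_nonneg x
  have hs0 : 0 ≤ ∑ j ∈ Finset.range ⌊x⌋₊, (Int.fract x + j) ^ (m - 1) :=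
    Finset.sum_nonneg fun j _ => by positivity
  have hs : ∑ j ∈ Finset.range ⌊x⌋₊, (Int.fract x + j) ^ (m - 1) ≤ x ^ m := by
    calc _ ≤ ∑ j ∈ Finset.range ⌊x⌋₊, x ^ (m - 1) := by
          refine Finset.sum_le_sum fun j hj => ?_
          have : (j:ℝ) ≤ ⌊x⌋₊ := by exact_mod_cast (Finset.mem_range.1 hj).le
          refine pow_le_pow_left₀ (by positivity) (by linarith) _
      _ = ⌊x⌋₊ * x ^ (m - 1) := by simp
      _ ≤ x * x ^ (m - 1) := by gcongr; exact Nat.floor_le hx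
      _ = x ^ m := by rw [← pow_succ']; congr 1; omega
  have hp := mul_le_mul_of_nonneg_left hs (cc_nonneg m)
  have hp0 := mul_nonneg (cc_nonneg m) hs0
  rw [h1, h2]
  rw [abs_le] at *
  constructor <;> linarith

lemma bb_lower : ∃ C : ℝ, 0 ≤ C ∧ ∀ m : ℕ, 2 ≤ m → ∀ x : ℝ, 1 ≤ x →
    cc m * (x - 1) ^ (m - 1) - 1 - C / 2 ^ m ≤ bb m x := by
  obtain ⟨C, hC, h⟩ := fourier_bound
  refine ⟨C, hC, fun m hm x hx => ?_⟩
  have hy := h m hm (Int.fract x) ⟨Int.fract_nonneg x, (Int.fract_lt_one x).le⟩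
  have hx' : Int.fract x + (⌊x⌋₊ : ℝ) = x := by
    rw [natCast_floor_eq_intCast_floor (by linarith)]; exact Int.fract_add_floor x
  have h1 := bb_add_nat m (Int.fract x) ⌊x⌋₊
  rw [hx'] at h1
  have hf := Int.fract_nonneg x
  have hfl : 1 ≤ ⌊x⌋₊ := Nat.le_floor (by simpa using hx)
  have hs : (x - 1) ^ (m - 1) ≤ ∑ j ∈ Finset.range ⌊x⌋₊, (Int.fract x + j) ^ (m - 1) := by
    have := Finset.single_le_sum (f := fun j : ℕ => (Int.fract x + j) ^ (m - 1))
      (s := Finset.range ⌊x⌋₊) (fun j _ => by positivity)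
      (Finset.mem_range.2 (show ⌊x⌋₊ - 1 < ⌊x⌋₊ by omega))
    refine le_trans (le_of_eq ?_) this
    rw [Nat.cast_sub hfl]
    congr 1; push_cast; linarith
  have hp := mul_le_mul_of_nonneg_left hs (cc_nonneg m)
  have hc := Real.cos_le_one (2 * π * Int.fract x - m * π / 2)
  rw [abs_le] at hy
  rw [h1]; linarith [hy.1]

lemma fact_lower (m : ℕ) (hm : 1 ≤ m) : ((m:ℝ) / exp 1) ^ m ≤ m.factorial := by
  refine le_trans ?_ (Stirling.le_factorial_stirling m)
  have : 1 ≤ √(2 * π * m) := by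
    rw [Real.one_le_sqrt]
    have : (1:ℝ) ≤ m := by exact_mod_cast hm
    nlinarith [Real.pi_gt_three]
  have h2 : 0 ≤ ((m:ℝ) / exp 1) ^ m := by positivity
  nlinarith

lemma fact_upper (m : ℕ) (hm : 1 ≤ m) : (m.factorial : ℝ) ≤ exp 1 * m * ((m:ℝ) / exp 1) ^ m := by
  obtain ⟨n, rfl⟩ : ∃ n, m = n + 1 := ⟨m - 1, by omega⟩
  have h := Stirling.stirlingSeq'_antitone (Nat.zero_le n)
  simp only [Function.comp] at h
  rw [show Nat.succ 0 = 1 from rfl, Stirling.stirlingSeq_one, Stirling.stirlingSeq,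
    div_le_iff₀ (by positivity)] at h
  refine h.trans ?_
  have hm' : (1:ℝ) ≤ ((n + 1 : ℕ) : ℝ) := by exact_mod_cast hm
  have h1 : √(((n + 1 : ℕ) : ℝ)) ≤ ((n + 1 : ℕ) : ℝ) := by
    rw [Real.sqrt_le_left (by positivity)]; nlinarith
  rw [Real.sqrt_mul (by norm_num)]
  have h2 : 0 ≤ (((n + 1 : ℕ):ℝ) / exp 1) ^ (n + 1) := by positivity
  calc _ = exp 1 * √(((n + 1 : ℕ) : ℝ)) * (((n + 1 : ℕ):ℝ) / exp 1) ^ (n + 1) := by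
        field_simp
    _ ≤ _ := by gcongr

/-- The critical scale. -/
noncomputable def MM (m : ℕ) : ℝ := m / (2 * π * exp 1)

lemma cc_small {q : ℝ} (hq0 : 0 < q) (hq1 : q < 1) :
    Tendsto (fun m : ℕ => cc m * (q * MM m) ^ m) atTop (𝓝 0) := by
  have ht : Tendsto (fun m : ℕ => (m:ℝ) * q ^ m) atTop (𝓝 0) :=
    tendsto_self_mul_const_pow_of_lt_one hq0.le hq1
  refine squeeze_zero' ?_ ?_ ht
  · exact Eventually.of_forall fun m => mul_nonneg (cc_nonneg m) (by unfold MM; positivity)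
  · filter_upwards [eventually_ge_atTop 1] with m hm
    have hf := fact_lower m hm
    have hfp : (0:ℝ) < m.factorial := by exact_mod_cast m.factorial_pos
    have : cc m * (q * MM m) ^ m = m * q ^ m * ((((m:ℝ) / exp 1) ^ m / m.factorial) / 2) := by
      unfold cc MM
      have e : (m:ℝ) / exp 1 = 2 * π * (m / (2 * π * exp 1)) := by field_simp
      rw [e, mul_pow, mul_pow (2 * π)]
      generalize (m:ℝ) / (2 * π * exp 1) = t
      field_simp
      simp only [mul_pow]
      ring
    rw [this]
    have h1 : ((m:ℝ) / exp 1) ^ m / m.factorial ≤ 1 := by rw [div_le_one hfp]; exact hf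
    refine mul_le_of_le_one_right (by positivity) (by linarith)

lemma cc_large {q : ℝ} (hq1 : 1 < q) :
    Tendsto (fun m : ℕ => cc m * (q * MM m) ^ (m - 1)) atTop atTop := by
  have hq0 : 0 < q := by linarith
  have h0 := tendsto_pow_const_div_const_pow_of_one_lt 1 hq1
  have h1 : Tendsto (fun m : ℕ => (m:ℝ) ^ 1 / q ^ m) atTop (𝓝[>] 0) := by
    rw [tendsto_nhdsWithin_iff]
    refine ⟨h0, ?_⟩
    filter_upwards [eventually_ge_atTop 1] with m hm
    have : (0:ℝ) < m := by exact_mod_cast hm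
    simp only [Set.mem_Ioi]; positivity
  have h2 := (h1.inv_tendsto_nhdsGT_zero).const_mul_atTop (show 0 < π / q by positivity)
  refine tendsto_atTop_mono' _ ?_ h2
  filter_upwards [eventually_ge_atTop 1] with m hm
  have hf := fact_upper m hm
  have hfp : (0:ℝ) < m.factorial := by exact_mod_cast m.factorial_pos
  have hm0 : (0:ℝ) < m := by exact_mod_cast hm
  have hM : 0 < MM m := by unfold MM; positivity
  have e1 : (q * MM m) ^ (m - 1) = (q * MM m) ^ m / (q * MM m) := by
    rw [eq_div_iff (by positivity), ← pow_succ]; congr 1; omega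
  have e2 : cc m * (q * MM m) ^ (m - 1) =
      π * exp 1 / q * q ^ m * (((m:ℝ) / exp 1) ^ m / m.factorial) := by
    rw [e1]
    have e : (m:ℝ) / exp 1 = 2 * π * MM m := by unfold MM; field_simp
    have e' : (m:ℝ) = 2 * π * MM m * exp 1 := by unfold MM; field_simp
    rw [e, mul_pow, mul_pow (2 * π)]
    unfold cc
    generalize MM m = t at *
    rw [e']
    field_simp
  rw [e2, Pi.inv_apply, pow_one, inv_div]
  have h3 : 1 / (exp 1 * m) ≤ ((m:ℝ) / exp 1) ^ m / m.factorial := by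
    rw [div_le_div_iff₀ (by positivity) hfp]; linarith
  calc π / q * (q ^ m / m) = π * exp 1 / q * q ^ m * (1 / (exp 1 * m)) := by field_simp
    _ ≤ _ := by gcongr

lemma err_small (C : ℝ) : Tendsto (fun m : ℕ => C / 2 ^ m) atTop (𝓝 0) := by
  have := (tendsto_pow_atTop_nhds_zero_of_lt_one (r := (1/2:ℝ)) (by norm_num) (by norm_num)).const_mul C
  simpa [div_eq_mul_inv] using this

lemma MM_tendsto : Tendsto MM atTop atTop := by
  unfold MM
  exact tendsto_natCast_atTop_atTop.atTop_div_const (by positivity)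

lemma P1 {q : ℝ} (hq0 : 0 < q) (hq1 : q < 1) : ∀ᶠ m : ℕ in atTop, ∀ x : ℝ, 0 ≤ x → x ≤ q * MM m →
    |bb m x + cos (2 * π * x - m * π / 2)| ≤ 1 / 2 := by
  obtain ⟨C, hC, h⟩ := bb_upper
  have h1 := (err_small C).eventually (gt_mem_nhds (show (0:ℝ) < 1/4 by norm_num))
  have h2 := (cc_small hq0 hq1).eventually (gt_mem_nhds (show (0:ℝ) < 1/4 by norm_num))
  filter_upwards [h1, h2, eventually_ge_atTop 2] with m h1 h2 hm x hx hxq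
  refine (h m hm x hx).trans ?_
  have := mul_le_mul_of_nonneg_left (pow_le_pow_left₀ hx hxq m) (cc_nonneg m)
  linarith

lemma P2 {q : ℝ} (hq1 : 1 < q) : ∀ᶠ m : ℕ in atTop, ∀ x : ℝ, q * MM m ≤ x → 0 < bb m x := by
  obtain ⟨C, hC, h⟩ := bb_lower
  have h1 := (err_small C).eventually (gt_mem_nhds (show (0:ℝ) < 1/4 by norm_num))
  have hp : 1 < (1 + q) / 2 := by linarith
  have h2 := (cc_large hp).eventually_ge_atTop 2
  have h3 := (MM_tendsto.const_mul_atTop (show 0 < (q - 1) / 2 by linarith)).eventually_ge_atTop 1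
  filter_upwards [h1, h2, h3, eventually_ge_atTop 2] with m h1 h2 h3 hm x hx
  have hM : 0 ≤ MM m := by unfold MM; positivity
  have hx1 : (1 + q) / 2 * MM m ≤ x - 1 := by linarith
  have hx0 : 0 ≤ (1 + q) / 2 * MM m := by positivity
  have h4 := h m hm x (by linarith)
  have := mul_le_mul_of_nonneg_left (pow_le_pow_left₀ hx0 hx1 (m - 1)) (cc_nonneg m)
  linarith

lemma bb_eq_zero {m : ℕ} {x : ℝ} : bb m x = 0 ↔ bernoulliFun m x = 0 := by
  unfold bb
  have : (2 * π) ^ m / (2 * (m.factorial : ℝ)) ≠ 0 := by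
    have := m.factorial_ne_zero
    positivity
  simp [this]

/-- The real zeros of the Bernoulli polynomial. -/
def Z (m : ℕ) : Set ℝ := {x | bernoulliFun m x = 0}

lemma mem_Z {m : ℕ} {x : ℝ} : x ∈ Z m ↔ bb m x = 0 := bb_eq_zero.symm

lemma finite_Z (m : ℕ) : (Z m).Finite := by
  have h0 : (Polynomial.bernoulli m).map (algebraMap ℚ ℝ) ≠ 0 := by
    rw [Polynomial.map_ne_zero_iff (algebraMap ℚ ℝ).injective]
    intro h
    have h1 := Polynomial.coeff_bernoulli m m
    rw [h] at h1
    simp at h1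
  refine (Polynomial.finite_setOfPred_isRoot h0).subset ?_
  intro x hx
  exact hx

lemma bb_continuous (m : ℕ) : Continuous (bb m) := by
  unfold bb
  exact (continuous_bernoulliFun m).mul continuous_const

lemma Z_reflect {m : ℕ} {x : ℝ} (hx : x ∈ Z m) : 1 - x ∈ Z m := by
  have h : bernoulliFun m x = 0 := hx
  show bernoulliFun m (1 - x) = 0
  rw [bernoulliFun_eval_one_sub, h, mul_zero]

lemma rolle {m : ℕ} (hm : 1 ≤ m) {x y : ℝ} (hxy : x < y) (hx : x ∈ Z m) (hy : y ∈ Z m) :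
    ∃ z ∈ Z (m - 1), x < z ∧ z < y := by
  have hx' : bernoulliFun m x = 0 := hx
  have hy' : bernoulliFun m y = 0 := hy
  obtain ⟨c, hc, h⟩ := exists_hasDerivAt_eq_zero hxy (continuous_bernoulliFun m).continuousOn
    (hx'.trans hy'.symm) (fun z _ => hasDerivAt_bernoulliFun m z)
  refine ⟨c, ?_, hc.1, hc.2⟩
  have : (m:ℝ) ≠ 0 := by positivity
  exact (mul_eq_zero.1 h).resolve_left this

lemma tail_count (R : ℝ) (n k : ℕ) :
    (Z (n + k) ∩ Set.Ici R).ncard ≤ (Z n ∩ Set.Ici R).ncard + k := by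
  induction k with
  | zero => simp
  | succ k ih =>
    have f1 : (Z (n + (k + 1)) ∩ Set.Ici R).Finite := (finite_Z _).inter_of_left _
    have f2 : (Z (n + k) ∩ Set.Ici R).Finite := (finite_Z _).inter_of_left _
    have h : (Z (n + (k + 1)) ∩ Set.Ici R).ncard ≤ (Z (n + k) ∩ Set.Ici R).ncard + 1 := by
      rw [Set.ncard_eq_toFinset_card _ f1, Set.ncard_eq_toFinset_card _ f2]
      refine Finset.card_le_of_interleaved ?_
      intro x hx y hy hxy _
      rw [Set.Finite.mem_toFinset] at hx hy
      obtain ⟨z, hz, h1, h2⟩ := rolle (by omega) hxy hx.1 hy.1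
      refine ⟨z, ?_, h1, h2⟩
      rw [Set.Finite.mem_toFinset]
      have hR : R ≤ x := hx.2
      exact ⟨hz, hR.trans h1.le⟩
    omega

/-- Phase. -/
lemma phase (m : ℕ) (x : ℝ) : 2 * π * x - m * π / 2 = π * (2 * x - m / 2) := by ring

lemma one_root {m : ℕ} (hm : 1 ≤ m) {R : ℝ}
    (h1 : ∀ x : ℝ, 0 ≤ x → x ≤ R → |bb m x + cos (2 * π * x - m * π / 2)| ≤ 1 / 2)
    (h2 : ∀ x : ℝ, 0 ≤ x → x ≤ R →
      |bb (m - 1) x + cos (2 * π * x - (m - 1 : ℕ) * π / 2)| ≤ 1 / 2)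
    {x y : ℝ} (hx0 : 0 ≤ x) (hyR : y ≤ R) (hx : x ∈ Z m) (hy : y ∈ Z m)
    (hf : ⌊2 * x - m / 2⌋ = ⌊2 * y - (m:ℝ) / 2⌋) : ¬ x < y := by
  intro hxy
  obtain ⟨z, hz, hxz, hzy⟩ := rolle hm hxy hx hy
  have ax := h1 x hx0 (by linarith)
  have ay := h1 y (by linarith) hyR
  have az := h2 z (by linarith) (by linarith)
  rw [mem_Z.1 hx, zero_add, phase] at ax
  rw [mem_Z.1 hy, zero_add, phase] at ay
  rw [mem_Z.1 hz, zero_add, Nat.cast_sub hm] at az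
  have e : 2 * π * z - ((m:ℝ) - (1:ℕ)) * π / 2 = π * (2 * z - m / 2) + π / 2 := by
    push_cast; ring
  rw [e, Real.cos_add_pi_div_two, abs_neg] at az
  set k := ⌊2 * x - (m:ℝ) / 2⌋ with hk
  have key : ∀ u : ℝ, |cos (π * u)| = |cos (π * u - k * π)| := by
    intro u
    rw [Real.cos_sub_int_mul_pi, abs_mul, abs_zpow, abs_neg, abs_one, one_zpow, one_mul]
  have hp := Real.pi_pos
  have kx : (k:ℝ) ≤ 2 * x - m / 2 := Int.floor_le _
  have ky : 2 * y - m / 2 < (k:ℝ) + 1 := by rw [hf]; exact Int.lt_floor_add_one _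
  have g : ∀ u : ℝ, π * u - k * π = π * (u - k) := fun u => by ring
  have o1 : cos (π * (2 * z - m / 2) - k * π) ≤ cos (π * (2 * x - m / 2) - k * π) := by
    apply Real.cos_le_cos_of_nonneg_of_le_pi
    · rw [g]; apply mul_nonneg hp.le; linarith
    · rw [g]; apply mul_le_of_le_one_right hp.le; linarith
    · rw [g, g]; apply mul_le_mul_of_nonneg_left _ hp.le; linarith
  have o2 : cos (π * (2 * y - m / 2) - k * π) ≤ cos (π * (2 * z - m / 2) - k * π) := by
    apply Real.cos_le_cos_of_nonneg_of_le_pi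
    · rw [g]; apply mul_nonneg hp.le; linarith
    · rw [g]; apply mul_le_of_le_one_right hp.le; linarith
    · rw [g, g]; apply mul_le_mul_of_nonneg_left _ hp.le; linarith
  rw [key, abs_le] at ax ay
  have bz : |cos (π * (2 * z - m / 2))| ≤ 1 / 2 := by
    rw [key, abs_le]; constructor <;> linarith [ax.1, ax.2, ay.1, ay.2]
  have := Real.sin_sq_add_cos_sq (π * (2 * z - m / 2))
  rw [abs_le] at az bz
  nlinarith [az.1, az.2, bz.1, bz.2]

lemma count_upper {m : ℕ} (hm : 1 ≤ m) {R : ℝ} (hR : 0 ≤ R)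
    (h1 : ∀ x : ℝ, 0 ≤ x → x ≤ R → |bb m x + cos (2 * π * x - m * π / 2)| ≤ 1 / 2)
    (h2 : ∀ x : ℝ, 0 ≤ x → x ≤ R →
      |bb (m - 1) x + cos (2 * π * x - (m - 1 : ℕ) * π / 2)| ≤ 1 / 2) :
    ((Z m ∩ Set.Icc 0 R).ncard : ℝ) ≤ 2 * R + 2 := by
  have hinj : Set.InjOn (fun x : ℝ => ⌊2 * x - (m:ℝ) / 2⌋) (Z m ∩ Set.Icc 0 R) := by
    intro x hx y hy hxy
    rcases lt_trichotomy x y with h | h | h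
    · exact absurd h (one_root hm h1 h2 hx.2.1 hy.2.2 hx.1 hy.1 hxy)
    · exact h
    · exact absurd h (one_root hm h1 h2 hy.2.1 hx.2.2 hy.1 hx.1 hxy.symm)
  have hsub : (fun x : ℝ => ⌊2 * x - (m:ℝ) / 2⌋) '' (Z m ∩ Set.Icc 0 R) ⊆
      ((Finset.Icc ⌊-(m:ℝ) / 2⌋ ⌊2 * R - (m:ℝ) / 2⌋ : Finset ℤ) : Set ℤ) := by
    rintro _ ⟨x, hx, rfl⟩
    simp only [Finset.coe_Icc, Set.mem_Icc]
    exact ⟨Int.floor_le_floor (by linarith [hx.2.1]), Int.floor_le_floor (by linarith [hx.2.2])⟩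
  have hc := Set.ncard_le_ncard hsub (Finset.finite_toSet _)
  rw [Set.InjOn.ncard_image hinj, Set.ncard_coe_finset, Int.card_Icc] at hc
  have hle : ⌊-(m:ℝ) / 2⌋ ≤ ⌊2 * R - (m:ℝ) / 2⌋ := Int.floor_le_floor (by linarith)
  have hc' : ((Z m ∩ Set.Icc 0 R).ncard : ℤ) ≤ ⌊2 * R - (m:ℝ) / 2⌋ + 1 - ⌊-(m:ℝ) / 2⌋ := by omega
  have hc'' : ((Z m ∩ Set.Icc 0 R).ncard : ℝ) ≤ ⌊2 * R - (m:ℝ) / 2⌋ + 1 - ⌊-(m:ℝ) / 2⌋ := by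
    exact_mod_cast hc'
  have a := Int.floor_le (2 * R - (m:ℝ) / 2)
  have b := Int.lt_floor_add_one (-(m:ℝ) / 2)
  linarith

/-- The points where the cosine is extremal. -/
noncomputable def pt (m : ℕ) (k : ℤ) : ℝ := (2 * k + m) / 4

lemma exists_root {m : ℕ} {R : ℝ}
    (h1 : ∀ x : ℝ, 0 ≤ x → x ≤ R → |bb m x + cos (2 * π * x - m * π / 2)| ≤ 1 / 2)
    (k : ℤ) (hk0 : 0 ≤ pt m k) (hkR : pt m (k + 1) ≤ R) :
    ∃ x ∈ Z m, pt m k < x ∧ x < pt m (k + 1) := by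
  have hlt : pt m k < pt m (k + 1) := by unfold pt; push_cast; linarith
  have a := h1 _ hk0 (by linarith)
  have b := h1 _ (by linarith) hkR
  have e : ∀ j : ℤ, 2 * π * pt m j - m * π / 2 = j * π := by intro j; unfold pt; ring
  rw [e, Real.cos_int_mul_pi] at a b
  rw [zpow_add_one₀ (by norm_num)] at b
  rw [abs_le] at a b
  have hc := (bb_continuous m).continuousOn (s := Set.Icc (pt m k) (pt m (k + 1)))
  rcases Int.even_or_odd k with hk | hk
  · rw [hk.neg_one_zpow] at a b
    obtain ⟨x, hx, h⟩ := intermediate_value_Ioo hlt.le hc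
      (show (0:ℝ) ∈ Set.Ioo _ _ from ⟨by linarith, by linarith⟩)
    exact ⟨x, mem_Z.2 h, hx.1, hx.2⟩
  · rw [hk.neg_one_zpow] at a b
    obtain ⟨x, hx, h⟩ := intermediate_value_Ioo' hlt.le hc
      (show (0:ℝ) ∈ Set.Ioo _ _ from ⟨by linarith, by linarith⟩)
    exact ⟨x, mem_Z.2 h, hx.1, hx.2⟩

lemma count_lower {m : ℕ} {R : ℝ}
    (h1 : ∀ x : ℝ, 0 ≤ x → x ≤ R → |bb m x + cos (2 * π * x - m * π / 2)| ≤ 1 / 2) :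
    2 * R - 3 ≤ ((Z m ∩ Set.Ioi (1 / 2)).ncard : ℝ) := by
  set a : ℤ := ⌈1 - (m:ℝ) / 2⌉
  set b : ℤ := ⌊2 * R - (m:ℝ) / 2⌋ - 1
  have ha : 1 - (m:ℝ) / 2 ≤ a := Int.le_ceil _
  have hb : (b:ℝ) + 1 ≤ 2 * R - (m:ℝ) / 2 := by
    simp only [b]; push_cast; linarith [Int.floor_le (2 * R - (m:ℝ) / 2)]
  have ha' : (a:ℝ) < 1 - (m:ℝ) / 2 + 1 := Int.ceil_lt_add_one _
  have hb' : 2 * R - (m:ℝ) / 2 < (b:ℝ) + 2 := by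
    simp only [b]; push_cast; linarith [Int.lt_floor_add_one (2 * R - (m:ℝ) / 2)]
  have hp : ∀ k : ℤ, a ≤ k → 1 / 2 ≤ pt m k := by
    intro k hk
    have : (a:ℝ) ≤ k := by exact_mod_cast hk
    unfold pt; linarith
  have hex : ∀ k : ℤ, ∃ x : ℝ, k ∈ Finset.Icc a b → x ∈ Z m ∧ pt m k < x ∧ x < pt m (k + 1) := by
    intro k
    by_cases hk : k ∈ Finset.Icc a b
    · rw [Finset.mem_Icc] at hk
      have hkb : (k:ℝ) ≤ b := by exact_mod_cast hk.2
      obtain ⟨x, hx⟩ := exists_root h1 k (by linarith [hp k hk.1])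
        (by unfold pt; push_cast; linarith)
      exact ⟨x, fun _ => hx⟩
    · exact ⟨0, fun h => absurd h hk⟩
  choose ρ hρ using hex
  have hinj : Set.InjOn ρ (Finset.Icc a b : Finset ℤ) := by
    have main : ∀ j ∈ Finset.Icc a b, ∀ k ∈ Finset.Icc a b, j < k → ρ j < ρ k := by
      intro j hj k hk hjk
      have : (j:ℝ) + 1 ≤ k := by exact_mod_cast hjk
      have h3 : pt m (j + 1) ≤ pt m k := by unfold pt; push_cast; linarith
      linarith [(hρ j hj).2.2, (hρ k hk).2.1]
    intro j hj k hk hjk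
    rcases lt_trichotomy j k with h | h | h
    · exact absurd hjk (main j hj k hk h).ne
    · exact h
    · exact absurd hjk (main k hk j hj h).ne'
  have hsub : ρ '' (Finset.Icc a b : Finset ℤ) ⊆ Z m ∩ Set.Ioi (1 / 2) := by
    rintro _ ⟨k, hk, rfl⟩
    have := hρ k hk
    refine ⟨this.1, ?_⟩
    have h3 := hp k (Finset.mem_Icc.1 hk).1
    show 1 / 2 < ρ k
    linarith [this.2.1]
  have hc := Set.ncard_le_ncard hsub ((finite_Z m).inter_of_left _)
  rw [Set.InjOn.ncard_image hinj, Set.ncard_coe_finset, Int.card_Icc] at hc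
  have hc' : b + 1 - a ≤ ((Z m ∩ Set.Ioi (1 / 2)).ncard : ℤ) := by omega
  have hc'' : (b:ℝ) + 1 - a ≤ ((Z m ∩ Set.Ioi (1 / 2)).ncard : ℝ) := by exact_mod_cast hc'
  linarith

lemma big_root {m : ℕ} {R : ℝ} (hR : 1 ≤ R)
    (h1 : ∀ x : ℝ, 0 ≤ x → x ≤ R → |bb m x + cos (2 * π * x - m * π / 2)| ≤ 1 / 2) :
    ∃ x ∈ Z m, R - 1 ≤ x := by
  have ha := Int.floor_le (2 * R - (m:ℝ) / 2)
  have hb := Int.lt_floor_add_one (2 * R - (m:ℝ) / 2)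
  obtain ⟨x, hx, h, _⟩ := exists_root h1 (⌊2 * R - (m:ℝ) / 2⌋ - 1)
    (by unfold pt; push_cast; linarith) (by unfold pt; push_cast; linarith)
  refine ⟨x, hx, ?_⟩
  unfold pt at h; push_cast at h; linarith

lemma half_count (m : ℕ) : 2 * (Z m ∩ Set.Ioi (1 / 2)).ncard ≤ (Z m).ncard ∧
    (Z m).ncard ≤ 2 * (Z m ∩ Set.Ioi (1 / 2)).ncard + 1 := by
  have hfin := finite_Z m
  have himg : (fun x : ℝ => 1 - x) '' (Z m ∩ Set.Ioi (1 / 2)) = Z m ∩ Set.Iio (1 / 2) := by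
    ext y
    constructor
    · rintro ⟨x, hx, rfl⟩
      refine ⟨Z_reflect hx.1, ?_⟩
      have : (1:ℝ) / 2 < x := hx.2
      show 1 - x < 1 / 2
      linarith
    · intro hy
      refine ⟨1 - y, ⟨Z_reflect hy.1, ?_⟩, by ring⟩
      have : y < (1:ℝ) / 2 := hy.2
      show 1 / 2 < 1 - y
      linarith
  have heq : (Z m ∩ Set.Iio (1 / 2)).ncard = (Z m ∩ Set.Ioi (1 / 2)).ncard := by
    rw [← himg, Set.ncard_image_of_injective]
    intro x y h
    simpa using h
  have hdis : Disjoint (Z m ∩ Set.Iio (1 / 2)) (Z m ∩ Set.Ioi (1 / 2)) := by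
    rw [Set.disjoint_left]
    intro x hx hy
    exact lt_asymm (show x < 1 / 2 from hx.2) (show 1 / 2 < x from hy.2)
  have hu := Set.ncard_union_eq hdis (hfin.inter_of_left _) (hfin.inter_of_left _)
  constructor
  · have : (Z m ∩ Set.Iio (1 / 2)) ∪ (Z m ∩ Set.Ioi (1 / 2)) ⊆ Z m :=
      Set.union_subset Set.inter_subset_left Set.inter_subset_left
    have := Set.ncard_le_ncard this hfin
    omega
  · have hs : Z m ⊆ insert (1 / 2) ((Z m ∩ Set.Iio (1 / 2)) ∪ (Z m ∩ Set.Ioi (1 / 2))) := by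
      intro x hx
      rcases lt_trichotomy x (1 / 2) with h | h | h
      · exact Or.inr (Or.inl ⟨hx, h⟩)
      · exact Or.inl h
      · exact Or.inr (Or.inr ⟨hx, h⟩)
    have h3 := Set.ncard_le_ncard hs
      (((hfin.inter_of_left _).union (hfin.inter_of_left _)).insert _)
    have h4 := Set.ncard_insert_le (1 / 2) ((Z m ∩ Set.Iio (1 / 2)) ∪ (Z m ∩ Set.Ioi (1 / 2)))
    omega

lemma tendsto_aux {f : ℕ → ℝ} {c K : ℝ} (hK : 0 < K)
    (h : ∀ ε : ℝ, 0 < ε → ε < 1 / 2 → ∀ᶠ m in atTop, c - K * ε ≤ f m ∧ f m ≤ c + K * ε) :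
    Tendsto f atTop (𝓝 c) := by
  rw [Metric.tendsto_nhds]
  intro δ hδ
  have hpos : 0 < min (1 / 4) (δ / (2 * K)) := lt_min (by norm_num) (by positivity)
  have hlt : min (1 / 4) (δ / (2 * K)) < 1 / 2 := (min_le_left _ _).trans_lt (by norm_num)
  have hle : K * min (1 / 4) (δ / (2 * K)) ≤ δ / 2 := by
    calc _ ≤ K * (δ / (2 * K)) := by gcongr; exact min_le_right _ _
      _ = δ / 2 := by field_simp
  filter_upwards [h _ hpos hlt] with m hm
  rw [Real.dist_eq, abs_lt]
  constructor <;> linarith [hm.1, hm.2]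

lemma d_pos : 0 < 1 / (2 * π * exp 1) := by positivity

lemma d_le : 1 / (2 * π * exp 1) ≤ 1 / 6 := by
  have h1 := Real.pi_gt_three
  have h2 : 1 ≤ exp 1 := Real.one_le_exp (by norm_num)
  apply one_div_le_one_div_of_le (by norm_num)
  nlinarith

lemma MM_eq (m : ℕ) : MM m = m * (1 / (2 * π * exp 1)) := by unfold MM; ring

lemma tail_upper {ε : ℝ} (h0 : 0 < ε) (h1 : ε < 1 / 2) : ∀ᶠ m : ℕ in atTop,
    ((Z m ∩ Set.Ici ((1 - ε) * MM m)).ncard : ℝ) ≤ 2 * ε * m + 1 := by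
  have hq : 1 < 1 / (1 - ε) := by rw [lt_div_iff₀ (by linarith)]; linarith
  have hp : 0 < (1 - ε) ^ 2 := by nlinarith
  have ht : Tendsto (fun m : ℕ => ⌊(1 - ε) ^ 2 * (m:ℝ)⌋₊) atTop atTop :=
    tendsto_nat_floor_atTop.comp (tendsto_natCast_atTop_atTop.const_mul_atTop hp)
  filter_upwards [ht.eventually (P2 hq)] with m hm
  set n := ⌊(1 - ε) ^ 2 * (m:ℝ)⌋₊
  have hm0 : (0:ℝ) ≤ m := Nat.cast_nonneg m
  have hn1 : (n:ℝ) ≤ (1 - ε) ^ 2 * m := Nat.floor_le (by positivity)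
  have hn2 : (1 - ε) ^ 2 * m < (n:ℝ) + 1 := Nat.lt_floor_add_one _
  have hnm : n ≤ m := by
    have h5 : (1 - ε) ^ 2 ≤ 1 := by nlinarith
    have : (n:ℝ) ≤ m := hn1.trans (mul_le_of_le_one_left hm0 h5)
    exact_mod_cast this
  have hempty : Z n ∩ Set.Ici ((1 - ε) * MM m) = ∅ := by
    rw [Set.eq_empty_iff_forall_notMem]
    intro x hx
    have hR : (1 - ε) * MM m ≤ x := hx.2
    have hle : 1 / (1 - ε) * MM n ≤ x := by
      refine le_trans ?_ hR
      rw [MM_eq, MM_eq, div_mul_eq_mul_div, div_le_iff₀ (by linarith)]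
      have := mul_le_mul_of_nonneg_right hn1 d_pos.le
      nlinarith
    exact (hm x hle).ne' (mem_Z.1 hx.1)
  have hc := tail_count ((1 - ε) * MM m) n (m - n)
  rw [hempty, Set.ncard_empty, Nat.add_sub_cancel' hnm, zero_add] at hc
  have hc' : ((Z m ∩ Set.Ici ((1 - ε) * MM m)).ncard : ℝ) ≤ (m:ℝ) - n := by
    rw [← Nat.cast_sub hnm]; exact_mod_cast hc
  nlinarith [mul_nonneg (sq_nonneg ε) hm0]

lemma small_inv {ε : ℝ} (h0 : 0 < ε) (K : ℝ) : ∀ᶠ m : ℕ in atTop, K ≤ ε * m ∧ (0:ℝ) < m := by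
  filter_upwards [(tendsto_natCast_atTop_atTop.const_mul_atTop h0).eventually_ge_atTop K,
    eventually_ge_atTop 1] with m hm h1
  exact ⟨hm, by exact_mod_cast h1⟩

lemma N_bounds {ε : ℝ} (h0 : 0 < ε) (h1 : ε < 1 / 2) : ∀ᶠ m : ℕ in atTop,
    2 / (π * exp 1) - 10 * ε ≤ ((Z m).ncard : ℝ) / m ∧
    ((Z m).ncard : ℝ) / m ≤ 2 / (π * exp 1) + 10 * ε := by
  have hp1 := P1 (q := 1 - ε) (by linarith) (by linarith)
  have hp2 := (tendsto_sub_atTop_nat 1).eventually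
    (P1 (q := 1 - ε / 2) (by linarith) (by linarith))
  filter_upwards [hp1, hp2, tail_upper h0 h1, small_inv h0 10, eventually_ge_atTop 1]
    with m hp1 hp2 htail hsm hm
  obtain ⟨hs, hm0⟩ := hsm
  have hc : 2 / (π * exp 1) = 4 * (1 / (2 * π * exp 1)) := by field_simp; norm_num
  rw [hc, le_div_iff₀ hm0, div_le_iff₀ hm0]
  have hR0 : 0 ≤ (1 - ε) * MM m := mul_nonneg (by linarith) (by unfold MM; positivity)
  obtain ⟨hh1, hh2⟩ := half_count m
  have hh1' : 2 * ((Z m ∩ Set.Ioi (1 / 2)).ncard : ℝ) ≤ (Z m).ncard := by exact_mod_cast hh1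
  have hh2' : ((Z m).ncard : ℝ) ≤ 2 * ((Z m ∩ Set.Ioi (1 / 2)).ncard : ℝ) + 1 := by
    exact_mod_cast hh2
  have hlow := count_lower hp1
  have hup := count_upper hm hR0 hp1 (by
    intro x hx hxR
    refine hp2 x hx (hxR.trans ?_)
    rw [MM_eq, MM_eq, Nat.cast_sub hm, ← mul_assoc, ← mul_assoc]
    apply mul_le_mul_of_nonneg_right _ d_pos.le
    push_cast
    nlinarith)
  have hsub : Z m ∩ Set.Ioi (1 / 2) ⊆
      (Z m ∩ Set.Icc 0 ((1 - ε) * MM m)) ∪ (Z m ∩ Set.Ici ((1 - ε) * MM m)) := by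
    intro x hx
    have hx2 : 1 / 2 < x := hx.2
    rcases le_total x ((1 - ε) * MM m) with h | h
    · exact Or.inl ⟨hx.1, by linarith, h⟩
    · exact Or.inr ⟨hx.1, h⟩
  have hcu := (Set.ncard_le_ncard hsub (((finite_Z m).inter_of_left _).union
    ((finite_Z m).inter_of_left _))).trans (Set.ncard_union_le _ _)
  have hcu' : ((Z m ∩ Set.Ioi (1 / 2)).ncard : ℝ) ≤
      (Z m ∩ Set.Icc 0 ((1 - ε) * MM m)).ncard + (Z m ∩ Set.Ici ((1 - ε) * MM m)).ncard := by
    exact_mod_cast hcu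
  rw [MM_eq] at *
  have hd0 := d_pos
  have hd1 := d_le
  generalize 1 / (2 * π * exp 1) = d at *
  have hem : 0 ≤ ε * m := by positivity
  have hemd : ε * m * d ≤ ε * m * (1 / 6) := mul_le_mul_of_nonneg_left hd1 hem
  have hemd0 : 0 ≤ ε * m * d := by positivity
  constructor <;> linarith

lemma A_bounds {ε : ℝ} (h0 : 0 < ε) (h1 : ε < 1 / 2) : ∀ᶠ m : ℕ in atTop,
    1 / (2 * π * exp 1) - 2 * ε ≤ sSup (Z m) / m ∧
    sSup (Z m) / m ≤ 1 / (2 * π * exp 1) + 2 * ε := by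
  have hp1 := P1 (q := 1 - ε) (by linarith) (by linarith)
  have hp2 := P2 (q := 1 + ε) (by linarith)
  have hM := (MM_tendsto.const_mul_atTop (show 0 < 1 - ε by linarith)).eventually_ge_atTop 1
  filter_upwards [hp1, hp2, hM, small_inv h0 10] with m hp1 hp2 hM hsm
  obtain ⟨hs, hm0⟩ := hsm
  rw [le_div_iff₀ hm0, div_le_iff₀ hm0]
  obtain ⟨x, hx, hxR⟩ := big_root hM hp1
  have l1 : x ≤ sSup (Z m) := le_csSup (finite_Z m).bddAbove hx
  have l2 : sSup (Z m) ≤ (1 + ε) * MM m := by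
    refine csSup_le ⟨x, hx⟩ fun y hy => ?_
    by_contra hcon
    exact (hp2 y (not_le.1 hcon).le).ne' (mem_Z.1 hy)
  rw [MM_eq] at *
  have hd0 := d_pos
  have hd1 := d_le
  generalize 1 / (2 * π * exp 1) = d at *
  have hem : 0 ≤ ε * m := by positivity
  have hemd : ε * m * d ≤ ε * m * (1 / 6) := mul_le_mul_of_nonneg_left hd1 hem
  have hemd0 : 0 ≤ ε * m * d := by positivity
  constructor <;> linarith

lemma root_set (m : ℕ) : {x : ℝ | (B m).IsRoot x} = Z m := rfl

end Inkeri

theorem stmt_14 :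
    Filter.Tendsto (fun m : ℕ => ({x : ℝ | (B m).IsRoot x}.ncard : ℝ) / m)
      Filter.atTop (nhds (2 / (π * Real.exp 1))) ∧
    Filter.Tendsto (fun m : ℕ => sSup {x : ℝ | (B m).IsRoot x} / m)
      Filter.atTop (nhds (1 / (2 * π * Real.exp 1))) := by
  simp only [Inkeri.root_set]
  exact ⟨Inkeri.tendsto_aux (by norm_num) fun ε h0 h1 => Inkeri.N_bounds h0 h1,
    Inkeri.tendsto_aux (by norm_num) fun ε h0 h1 => Inkeri.A_bounds h0 h1⟩
end

section
/- For every real σ with σ ≠ 1, the value hurwitzZeta σ (1/2) equals zero if and only if σ = 0 or σ is a negative even integer (σ ∈ {−2, −4, −6, ...}). -/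
open Real HurwitzZeta

/-- Negated partial sums of `(-1)^k`, cut off to `t > 1`. -/
noncomputable def altSum (t : ℝ) : ℝ :=
  (Set.Ioi (1 : ℝ)).indicator (fun t ↦ if Odd ⌊t⌋₊ then (1 : ℝ) else 0) t

lemma altSum_nonneg (t : ℝ) : 0 ≤ altSum t := by
  unfold altSum
  apply Set.indicator_nonneg
  intro t _
  split_ifs <;> norm_num

lemma altSum_le (t : ℝ) : altSum t ≤ 1 := by
  unfold altSum
  apply Set.indicator_apply_le'
  · intro _
    split_ifs <;> norm_num
  · intro _; norm_num

lemma altSum_measurable : Measurable altSum := by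
  unfold altSum
  refine Measurable.indicator ?_ measurableSet_Ioi
  exact (Measurable.of_discrete (f := fun n : ℕ ↦ if Odd n then (1 : ℝ) else 0)).comp
    Nat.measurable_floor

lemma cexp_half_alt (k : ℕ) :
    Complex.exp (2 * π * Complex.I * (((1 : ℝ) / 2 : ℝ) : ℂ) * k) = (-1) ^ k := by
  rw [show (2 * π * Complex.I * (((1 : ℝ) / 2 : ℝ) : ℂ) * k : ℂ) = k * (π * Complex.I) by
    push_cast; ring, Complex.exp_nat_mul, Complex.exp_pi_mul_I]

lemma sum_alt (n : ℕ) :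
    ∑ k ∈ Finset.Icc 1 n, Complex.exp (2 * π * Complex.I * (((1 : ℝ) / 2 : ℝ) : ℂ) * k)
      = -(if Odd n then 1 else 0) := by
  simp_rw [cexp_half_alt]
  induction n with
  | zero => simp
  | succ n ih =>
    rw [Finset.sum_Icc_succ_top (by omega), ih]
    by_cases h : Odd n
    · have h2 : Even (n + 1) := h.add_one
      simp [h, h2.neg_one_pow, Nat.not_odd_iff_even.mpr h2]
    · have h2 : Odd (n + 1) := (Nat.not_odd_iff_even.mp h).add_one
      simp [h, h2.neg_one_pow, h2]

lemma altSum_locInt : MeasureTheory.LocallyIntegrableOn (fun t ↦ (altSum t : ℂ)) (Set.Ioi 0) := by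
  apply MeasureTheory.LocallyIntegrable.locallyIntegrableOn
  refine (MeasureTheory.locallyIntegrable_const (1 : ℂ)).mono
    (Complex.measurable_ofReal.comp altSum_measurable).aestronglyMeasurable ?_
  filter_upwards with t
  simpa [abs_of_nonneg (altSum_nonneg t)] using altSum_le t

lemma altSum_top : (fun t ↦ (altSum t : ℂ)) =O[Filter.atTop] (fun t : ℝ ↦ t ^ (-(0 : ℝ))) := by
  refine Asymptotics.IsBigO.of_bound 1 ?_
  filter_upwards with t
  simpa [abs_of_nonneg (altSum_nonneg t)] using altSum_le t

lemma altSum_bot (b : ℝ) :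
    (fun t ↦ (altSum t : ℂ)) =O[nhdsWithin 0 (Set.Ioi 0)] (fun t : ℝ ↦ t ^ (-b)) := by
  refine Asymptotics.IsBigO.of_bound 1 ?_
  have : ∀ᶠ t : ℝ in nhdsWithin 0 (Set.Ioi 0), t < 1 :=
    nhdsWithin_le_nhds (eventually_lt_nhds one_pos)
  filter_upwards [this] with t ht
  have : altSum t = 0 := by simp [altSum, ht.le]
  rw [this]
  simp

lemma mellin_conv {s : ℂ} (hs : s.re < 0) : MellinConvergent (fun t ↦ (altSum t : ℂ)) s :=
  mellinConvergent_of_isBigO_rpow altSum_locInt altSum_top hs (altSum_bot (s.re - 1)) (by linarith)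

lemma mellin_diff {s : ℂ} (hs : s.re < 0) :
    DifferentiableAt ℂ (mellin (fun t ↦ (altSum t : ℂ))) s :=
  mellin_differentiableAt_of_isBigO_rpow altSum_locInt altSum_top hs (altSum_bot (s.re - 1))
    (by linarith)

lemma expZeta_eq_of_one_lt {s : ℂ} (hs : 1 < s.re) :
    expZeta (((1 : ℝ) / 2 : ℝ) : UnitAddCircle) s
      = -s * mellin (fun t ↦ (altSum t : ℂ)) (-s) := by
  have h := LSeriesHasSum_exp ((1 : ℝ) / 2) hs
  rw [← h.LSeries_eq, LSeries_eq_mul_integral _ le_rfl (by linarith) h.LSeriesSummable]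
  · rw [neg_mul, ← mul_neg]
    congr 1
    rw [mellin, MeasureTheory.setIntegral_eq_of_subset_of_forall_sdiff_eq_zero measurableSet_Ioi
      (Set.Ioi_subset_Ioi (zero_le_one (α := ℝ))) (f := fun t : ℝ ↦
        (t : ℂ) ^ (-s - 1) • (altSum t : ℂ)), ← MeasureTheory.integral_neg]
    · refine MeasureTheory.setIntegral_congr_fun measurableSet_Ioi fun t ht ↦ ?_
      simp only [sum_alt, altSum, Set.indicator_of_mem ht, smul_eq_mul]
      rw [show -(s + 1) = -s - 1 by ring]
      split_ifs <;> simp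
    · intro t ht
      have : altSum t = 0 := by simp only [altSum]; exact Set.indicator_of_notMem ht.2 _
      simp [this]
  · refine Asymptotics.IsBigO.of_bound 1 ?_
    filter_upwards with n
    rw [sum_alt]
    split_ifs <;> simp

lemma half_ne_zero : (((1 : ℝ) / 2 : ℝ) : UnitAddCircle) ≠ 0 := by
  intro h
  rw [AddCircle.coe_eq_zero_iff] at h
  obtain ⟨n, hn⟩ := h
  have h2 : (2 * n : ℝ) = 1 := by
    simp only [zsmul_eq_mul, mul_one] at hn
    linarith
  have : 2 * n = 1 := by exact_mod_cast h2
  omega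

lemma expZeta_eq_of_pos {s : ℂ} (hs : 0 < s.re) :
    expZeta (((1 : ℝ) / 2 : ℝ) : UnitAddCircle) s
      = -s * mellin (fun t ↦ (altSum t : ℂ)) (-s) := by
  have hopen : IsOpen {z : ℂ | 0 < z.re} := isOpen_lt continuous_const Complex.continuous_re
  have h1 : AnalyticOnNhd ℂ (expZeta (((1 : ℝ) / 2 : ℝ) : UnitAddCircle)) {z : ℂ | 0 < z.re} :=
    (differentiable_expZeta_of_ne_zero half_ne_zero).differentiableOn.analyticOnNhd hopen
  have h2 : AnalyticOnNhd ℂ (fun s ↦ -s * mellin (fun t ↦ (altSum t : ℂ)) (-s))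
      {z : ℂ | 0 < z.re} := by
    apply DifferentiableOn.analyticOnNhd _ hopen
    intro z hz
    apply DifferentiableAt.differentiableWithinAt
    apply differentiableAt_id.neg.mul
    exact DifferentiableAt.comp z (g := mellin (fun t ↦ (altSum t : ℂ))) (f := fun z ↦ -z)
      (mellin_diff (by simpa using hz)) differentiableAt_id.neg
  have hconn : IsPreconnected {z : ℂ | 0 < z.re} := (convex_halfSpace_re_gt 0).isPreconnected
  refine h1.eqOn_of_preconnected_of_eventuallyEq h2 hconn (z₀ := 2) (by simp) ?_ hs
  have : ∀ᶠ z : ℂ in nhds 2, 1 < z.re :=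
    (isOpen_lt continuous_const Complex.continuous_re).mem_nhds (by simp)
  filter_upwards [this] with z hz using expZeta_eq_of_one_lt hz

lemma expZeta_ne_zero {x : ℝ} (hx : 0 < x) :
    expZeta (((1 : ℝ) / 2 : ℝ) : UnitAddCircle) (x : ℂ) ≠ 0 := by
  rw [expZeta_eq_of_pos (by simpa using hx)]
  refine mul_ne_zero (by simpa using hx.ne') ?_
  have key : ∀ t ∈ Set.Ioi (0 : ℝ), (t : ℂ) ^ (-(x : ℂ) - 1) • (altSum t : ℂ)
      = ((t ^ (-x - 1) * altSum t : ℝ) : ℂ) := by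
    intro t ht
    rw [smul_eq_mul, Complex.ofReal_mul, Complex.ofReal_cpow (le_of_lt ht)]
    push_cast
    rfl
  have hc := mellin_conv (s := -(x : ℂ)) (by simpa using hx)
  rw [MellinConvergent, MeasureTheory.integrableOn_congr_fun key measurableSet_Ioi] at hc
  have hc' : MeasureTheory.IntegrableOn (fun t : ℝ ↦ t ^ (-x - 1) * altSum t) (Set.Ioi 0) := by
    have := MeasureTheory.Integrable.re hc
    simp only [RCLike.re_eq_complex_re, Complex.ofReal_re] at this
    exact this
  rw [mellin, MeasureTheory.setIntegral_congr_fun measurableSet_Ioi key, integral_complex_ofReal]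
  rw [Complex.ofReal_ne_zero]
  apply ne_of_gt
  rw [MeasureTheory.setIntegral_pos_iff_support_of_nonneg_ae _ hc']
  · refine lt_of_lt_of_le (b := MeasureTheory.volume (Set.Ioo (1 : ℝ) 2)) (by simp) ?_
    apply MeasureTheory.measure_mono
    intro t ht
    have h0 : (0 : ℝ) < t := by linarith [ht.1]
    refine ⟨?_, h0⟩
    have hf : ⌊t⌋₊ = 1 := by
      rw [Nat.floor_eq_iff h0.le]
      norm_num
      exact ⟨ht.1.le, ht.2⟩
    have : altSum t = 1 := by
      rw [altSum, Set.indicator_of_mem (show t ∈ Set.Ioi (1 : ℝ) from ht.1), hf]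
      simp
    rw [Function.mem_support, this, mul_one]
    exact (Real.rpow_pos_of_pos h0 _).ne'
  · filter_upwards [MeasureTheory.ae_restrict_mem measurableSet_Ioi] with t ht
    exact mul_nonneg (Real.rpow_nonneg (le_of_lt ht) _) (altSum_nonneg t)

lemma hurwitz_ne_zero_of_one_lt {x : ℝ} (hx : 1 < x) :
    hurwitzZeta (((1 : ℝ) / 2 : ℝ) : UnitAddCircle) (x : ℂ) ≠ 0 := by
  have h := hasSum_hurwitzZeta_of_one_lt_re (a := (1 : ℝ) / 2) (by constructor <;> norm_num)
    (s := (x : ℂ)) (by simpa using hx)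
  have key : ∀ n : ℕ, 1 / ((n : ℂ) + (((1 : ℝ) / 2 : ℝ) : ℂ)) ^ (x : ℂ)
      = ((1 / ((n : ℝ) + 1 / 2) ^ x : ℝ) : ℂ) := by
    intro n
    rw [Complex.ofReal_div (1 : ℝ) (((n : ℝ) + 1 / 2) ^ x),
      Complex.ofReal_cpow (by positivity)]
    push_cast
    rfl
  simp_rw [key] at h
  intro h0
  rw [h0] at h
  have h' : HasSum (fun n : ℕ ↦ 1 / ((n : ℝ) + 1 / 2) ^ x) 0 := by
    rw [← Complex.ofReal_zero] at h
    exact Complex.hasSum_ofReal.mp h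
  have := (hasSum_zero_iff_of_nonneg (fun n ↦ by positivity)).mp h'
  have h3 := congrFun this 0
  have h4 : (0 : ℝ) < 1 / (((0 : ℕ) : ℝ) + 1 / 2) ^ x := by positivity
  exact h4.ne' h3

lemma neg_half : -(((1 : ℝ) / 2 : ℝ) : UnitAddCircle) = (((1 : ℝ) / 2 : ℝ) : UnitAddCircle) := by
  rw [← AddCircle.coe_neg, ← sub_eq_zero, ← AddCircle.coe_sub, AddCircle.coe_eq_zero_iff]
  exact ⟨-1, by norm_num⟩

lemma hurwitz_one_sub_zero_iff {x : ℝ} (hx : 0 < x) :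
    hurwitzZeta (((1 : ℝ) / 2 : ℝ) : UnitAddCircle) (1 - (x : ℂ)) = 0 ↔
      Real.cos (π * x / 2) = 0 := by
  rw [hurwitzZeta_one_sub _ _ (Or.inl half_ne_zero), neg_half, ← add_mul,
    show Complex.exp (-π * Complex.I * x / 2) + Complex.exp (π * Complex.I * x / 2)
      = 2 * Complex.cos (π * x / 2) by
        rw [Complex.cos]
        ring_nf]
  · have h1 : Complex.Gamma x ≠ 0 := Complex.Gamma_ne_zero_of_re_pos (by simpa using hx)
    have h2 : (2 * π : ℂ) ^ (-(x : ℂ)) ≠ 0 := by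
      rw [Complex.cpow_ne_zero_iff]
      left
      exact mul_ne_zero two_ne_zero (by exact_mod_cast Real.pi_ne_zero)
    simp only [mul_eq_zero, h1, h2, expZeta_ne_zero hx, false_or, or_false, two_ne_zero]
    rw [← Complex.ofReal_eq_zero]
    push_cast
    rfl
  · intro n h
    have : x = -(n : ℝ) := by exact_mod_cast h
    have : (0 : ℝ) ≤ n := n.cast_nonneg
    linarith

theorem stmt_15 (σ : ℝ) (hσ : σ ≠ 1) :
    hurwitzZeta (((1 : ℝ) / 2 : ℝ) : UnitAddCircle) (σ : ℂ) = 0 ↔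
      σ = 0 ∨ ∃ k : ℕ, σ = -(2 * ((k : ℝ) + 1)) := by
  rcases lt_or_gt_of_ne hσ with h | h
  · have e : (σ : ℂ) = 1 - ((1 - σ : ℝ) : ℂ) := by push_cast; ring
    rw [e, hurwitz_one_sub_zero_iff (by linarith), Real.cos_eq_zero_iff]
    have hpi := Real.pi_ne_zero
    constructor
    · rintro ⟨k, hk⟩
      have h1 : 1 - σ = 2 * k + 1 := by
        have : π * (1 - σ) = π * (2 * k + 1) := by linarith
        exact mul_left_cancel₀ hpi this
      have h2 : σ = -(2 * k) := by linarith
      have h3 : (-1 : ℝ) < k := by linarith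
      have h4 : -1 < k := by exact_mod_cast h3
      obtain ⟨m, rfl⟩ := Int.eq_ofNat_of_zero_le (show 0 ≤ k by omega)
      rcases m with _ | m
      · left; simpa using h2
      · right
        exact ⟨m, by rw [h2]; push_cast; ring⟩
    · rintro (rfl | ⟨k, rfl⟩)
      · exact ⟨0, by simp⟩
      · exact ⟨k + 1, by push_cast; ring⟩
  · refine iff_of_false (hurwitz_ne_zero_of_one_lt h) ?_
    rintro (rfl | ⟨k, rfl⟩)
    · linarith
    · have : (0 : ℝ) ≤ k := k.cast_nonneg
      linarith
end
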